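/- For each t > 0 let 𝒫_t be a Poisson point process on ℝ^d with constant intensity t, and set L_t = ℓ(𝒫_t ∩ [0,1]^d). Let (t_n)_{n∈ℕ} be an increasing sequence of positive real numbers such that ∑_{n=1}^∞ exp(−ε t_n^{1/d}) < ∞ for every ε > 0. Then t_n^{-1/d} L_{t_n} converges completely to c_d: for every ε > 0, ∑_{n=1}^∞ P(|t_n^{-1/d} L_{t_n} − c_d| > ε) < ∞. -/

import Mathlib

open MeasureTheory Filter Set Topology

noncomputable section

/-- `ℓ(A)`: the maximal cardinality of a chain (finite subset totally ordered by the
coordinatewise partial order `≤`) contained in `A ⊆ ℝ^d`. -/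
def chainLength (d : ℕ) (A : Set (Fin d → ℝ)) : ℕ :=
  sSup {n : ℕ | ∃ C : Finset (Fin d → ℝ),
    ↑C ⊆ A ∧ IsChain (· ≤ ·) (C : Set (Fin d → ℝ)) ∧ C.card = n}

/-- The class `ℬ` of nonnegative, locally bounded, Lebesgue-measurable functions. -/
def MemB (d : ℕ) (f : (Fin d → ℝ) → ℝ) : Prop :=
  Measurable f ∧ (∀ x, 0 ≤ f x) ∧ ∀ x : Fin d → ℝ, ∃ U ∈ 𝓝 x, BddAbove (f '' U)

/-- The Euclidean norm on `ℝ^d` (modelled as `Fin d → ℝ`). -/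
def euclNorm (d : ℕ) (x : Fin d → ℝ) : ℝ := Real.sqrt (∑ i, (x i) ^ 2)

/-- The expectation `E[ℓ_n]` of the length of a longest chain among `n` i.i.d. points
uniformly distributed in the unit cube `[0,1]^d`. -/
def BWexpect (d n : ℕ) : ℝ :=
  ∫ X : Fin n → Fin d → ℝ, (chainLength d (Set.range X) : ℝ)
    ∂(Measure.pi fun _ => volume.restrict (Set.Icc (0 : Fin d → ℝ) 1))

/-- `c` is the Bollobás–Winkler constant `c_d`: `c > 0` and `n^{-1/d} E[ℓ_n] → c`. -/
def IsBWConstant (d : ℕ) (c : ℝ) : Prop :=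
  0 < c ∧ Tendsto (fun n : ℕ => (n : ℝ) ^ (-(1 : ℝ) / d) * BWexpect d n) atTop (nhds c)

/-- A Poisson point process on `ℝ^d` with intensity function `g`, on a probability space
`(Ω, P)`: a random at-most-countable subset of `ℝ^d` such that for every bounded Borel set `A`
the count `#(pts ω ∩ A)` is measurable with Poisson distribution of mean `∫_A g`, and counts of
pairwise disjoint Borel sets are independent. -/
structure PoissonPP (d : ℕ) {Ω : Type*} [MeasurableSpace Ω] (P : Measure Ω)
    (g : (Fin d → ℝ) → ℝ) where
  pts : Ω → Set (Fin d → ℝ)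
  countable : ∀ ω, (pts ω).Countable
  measur : ∀ A : Set (Fin d → ℝ), MeasurableSet A → Bornology.IsBounded A →
    ∀ k : ℕ, MeasurableSet {ω | (pts ω ∩ A).encard = k}
  poisson : ∀ A : Set (Fin d → ℝ), MeasurableSet A → Bornology.IsBounded A →
    ∀ k : ℕ, P {ω | (pts ω ∩ A).encard = k}
      = ENNReal.ofReal (Real.exp (-(∫ x in A, g x)) * (∫ x in A, g x) ^ k / k.factorial)
  indep : ∀ (n : ℕ) (A : Fin n → Set (Fin d → ℝ)),
    (∀ i, MeasurableSet (A i)) → (∀ i, Bornology.IsBounded (A i)) →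
    (Pairwise fun i j => Disjoint (A i) (A j)) →
    ∀ k : Fin n → ℕ,
      P (⋂ i, {ω | (pts ω ∩ A i).encard = k i})
        = ∏ i, P {ω | (pts ω ∩ A i).encard = k i}

/-- Upper semicontinuous envelope `f*`. -/
def upperEnv (d : ℕ) (f : (Fin d → ℝ) → ℝ) (x : Fin d → ℝ) : ℝ := limsup f (𝓝 x)

/-- Lower semicontinuous envelope `f_*`. -/
def lowerEnv (d : ℕ) (f : (Fin d → ℝ) → ℝ) (x : Fin d → ℝ) : ℝ := liminf f (𝓝 x)

/-- The simplex `S_{x,v} = {z : z ≤ x, ⟨x-z,v⟩ ≤ 1}`. -/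
def simplexS (d : ℕ) (x v : Fin d → ℝ) : Set (Fin d → ℝ) :=
  {z | z ≤ x ∧ ∑ i, (x i - z i) * v i ≤ 1}

/-- `u` is a nondecreasing viscosity solution of the problem (P):
`u_{x_1} ⋯ u_{x_d} = (c_d/d)^d f` in `(0,∞)^d`, `u = 0` on `∂ℝ^d_+`. -/
def IsNDViscSol (d : ℕ) (c : ℝ) (f u : (Fin d → ℝ) → ℝ) : Prop :=
  ContinuousOn u (Set.Ici 0) ∧
  (∀ x y : Fin d → ℝ, 0 ≤ x → x ≤ y → u x ≤ u y) ∧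
  (∀ x : Fin d → ℝ, 0 ≤ x → (∃ i, x i = 0) → u x = 0) ∧
  (∀ x₀ : Fin d → ℝ, (∀ i, 0 < x₀ i) →
    ∀ φ : (Fin d → ℝ) → ℝ, ContDiff ℝ ((⊤ : ℕ∞) : WithTop ℕ∞) φ →
      IsLocalMaxOn (fun y => u y - φ y) (Set.Ici 0) x₀ →
      ∏ i, fderiv ℝ φ x₀ (Pi.single i 1) ≤ (c / d) ^ d * upperEnv d f x₀) ∧
  (∀ x₀ : Fin d → ℝ, (∀ i, 0 < x₀ i) →
    ∀ φ : (Fin d → ℝ) → ℝ, ContDiff ℝ ((⊤ : ℕ∞) : WithTop ℕ∞) φ →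
      IsLocalMinOn (fun y => u y - φ y) (Set.Ici 0) x₀ →
      (c / d) ^ d * lowerEnv d f x₀ ≤ ∏ i, fderiv ℝ φ x₀ (Pi.single i 1))

theorem integrable_of_measurable_of_abs_le {α : Type*} [MeasurableSpace α] {μ : Measure α}
    [IsFiniteMeasure μ] {f : α → ℝ} (hf : Measurable f) (C : ℝ) (hC : ∀ x, |f x| ≤ C) :
    Integrable f μ :=
  Integrable.of_bound hf.aestronglyMeasurable C (ae_of_all _ hC)

theorem integral_sub_add {α : Type*} [MeasurableSpace α] {μ : Measure α} {f g k : α → ℝ}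
    (hf : Integrable f μ) (hg : Integrable g μ) (hk : Integrable k μ) :
    ∫ x, f x - g x + k x ∂μ = ∫ x, f x ∂μ - ∫ x, g x ∂μ + ∫ x, k x ∂μ := by
  rw [integral_add (f := fun x => f x - g x) (hf.sub hg) hk, integral_sub hf hg]

theorem measurable_finCons {E : Type*} [MeasurableSpace E] {n : ℕ} :
    Measurable fun p : E × (Fin n → E) => (Fin.cons p.1 p.2 : Fin (n + 1) → E) := by
  refine measurable_pi_iff.2 fun i => ?_
  refine Fin.cases ?_ (fun j => ?_) i
  · simpa using measurable_fst
  · simpa [Function.comp_def] using (measurable_pi_apply j).comp measurable_snd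

theorem measurePreserving_finCons {E : Type*} [MeasurableSpace E] (ν : Measure E)
    [IsProbabilityMeasure ν] (n : ℕ) :
    MeasurePreserving (fun p : E × (Fin n → E) => (Fin.cons p.1 p.2 : Fin (n + 1) → E))
      (ν.prod (Measure.pi fun _ => ν)) (Measure.pi fun _ => ν) := by
  have h := (measurePreserving_piFinSuccAbove (fun _ : Fin (n + 1) => ν) 0).symm
  convert h using 2
  simp [MeasurableEquiv.piFinSuccAbove_symm_apply, Fin.insertNthEquiv]

theorem integral_pi_succ {E : Type*} [MeasurableSpace E] (ν : Measure E)
    [IsProbabilityMeasure ν] {n : ℕ} {f : (Fin (n + 1) → E) → ℝ} (hf : Measurable f) (C : ℝ)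
    (hC : ∀ x, |f x| ≤ C) :
    ∫ x, f x ∂(Measure.pi fun _ => ν) =
      ∫ y, ∫ z, f (Fin.cons y z) ∂(Measure.pi fun _ : Fin n => ν) ∂ν := by
  have h := measurePreserving_finCons ν n
  rw [← h.map_eq, integral_map h.measurable.aemeasurable hf.aestronglyMeasurable,
    integral_prod]
  exact integrable_of_measurable_of_abs_le (hf.comp h.measurable) C fun _ => hC _

/-- Subadditivity (tensorization) of the entropy of `exp φ` for a product measure, each
coordinate entropy being bounded by its variational expression at `exp (v i)`. -/
theorem entropy_pi_le {E : Type*} [MeasurableSpace E] (ν : Measure E)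
    [IsProbabilityMeasure ν] : ∀ (n : ℕ) (φ : (Fin n → E) → ℝ) (v : Fin n → (Fin n → E) → ℝ)
    (C : ℝ), Measurable φ → (∀ x, |φ x| ≤ C) → (∀ i, Measurable (v i)) →
    (∀ i x, |v i x| ≤ C) → (∀ i x y, v i (Function.update x i y) = v i x) →
    ∫ x, φ x * Real.exp (φ x) ∂(Measure.pi fun _ => ν) -
      (∫ x, Real.exp (φ x) ∂(Measure.pi fun _ => ν)) *
        Real.log (∫ x, Real.exp (φ x) ∂(Measure.pi fun _ => ν)) ≤
    ∑ i, ∫ x, (φ x * Real.exp (φ x) - v i x * Real.exp (φ x) - Real.exp (φ x)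
      + Real.exp (v i x)) ∂(Measure.pi fun _ => ν) := by
  intro n
  induction n with
  | zero =>
    intro φ v C _ _ _ _ _
    have h : ∀ x, φ x = φ default := fun x => by rw [Subsingleton.elim x default]
    simp only [h]
    simp
    ring_nf
    simp
  | succ n ih =>
    intro φ v C hφ hφC hv hvC hvi
    set μ : Measure (Fin n → E) := Measure.pi fun _ => ν
    have hcons : ∀ y, Measurable fun z : Fin n → E => (Fin.cons y z : Fin (n + 1) → E) :=
      fun y => measurable_finCons.comp (measurable_const.prodMk measurable_id)
    have hexp : ∀ r : ℝ, |r| ≤ C → Real.exp r ≤ Real.exp C := fun r hr =>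
      Real.exp_le_exp.2 (abs_le.1 hr).2
    have hexp' : ∀ r : ℝ, |r| ≤ C → Real.exp (-C) ≤ Real.exp r := fun r hr =>
      Real.exp_le_exp.2 (abs_le.1 hr).1
    have hZint : ∀ y, Integrable (fun z => Real.exp (φ (Fin.cons y z))) μ := fun y =>
      integrable_of_measurable_of_abs_le ((hφ.comp (hcons y)).exp) (Real.exp C) fun z => by
        rw [abs_of_pos (Real.exp_pos _)]; exact hexp _ (hφC _)
    set h : E → ℝ := fun y => ∫ z, Real.exp (φ (Fin.cons y z)) ∂μ with hh
    have hhm : Measurable h := by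
      have : Measurable fun p : E × (Fin n → E) => Real.exp (φ (Fin.cons p.1 p.2)) :=
        (hφ.comp measurable_finCons).exp
      exact (this.stronglyMeasurable.integral_prod_right).measurable
    have hhu : ∀ y, h y ≤ Real.exp C := fun y => by
      have := integral_mono (hZint y) (integrable_const (Real.exp C)) fun z => hexp _ (hφC _)
      simpa using this
    have hhl : ∀ y, Real.exp (-C) ≤ h y := fun y => by
      have := integral_mono (integrable_const (Real.exp (-C))) (hZint y) fun z => hexp' _ (hφC _)
      simpa using this
    have hhp : ∀ y, 0 < h y := fun y => (Real.exp_pos _).trans_le (hhl y)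
    have hhabs : ∀ y, |h y| ≤ Real.exp C := fun y => by
      rw [abs_of_pos (hhp y)]; exact hhu y
    have hhint : Integrable h ν := integrable_of_measurable_of_abs_le hhm _ hhabs
    set H : ℝ := ∫ y, h y ∂ν with hH
    have hHl : Real.exp (-C) ≤ H := by
      have := integral_mono (integrable_const (Real.exp (-C))) hhint hhl
      simpa using this
    have hHp : 0 < H := (Real.exp_pos _).trans_le hHl
    have hlogh : ∀ y, |Real.log (h y)| ≤ C := fun y => by
      rw [abs_le]
      constructor
      · rw [← Real.log_exp (-C)]; exact Real.log_le_log (Real.exp_pos _) (hhl y)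
      · rw [← Real.log_exp C]; exact Real.log_le_log (hhp y) (hhu y)
    have hC : 0 ≤ C := (abs_nonneg _).trans (hlogh (Classical.choice ν.nonempty_of_neZero))
    -- bounds for the integrands
    have hb1 : ∀ r : ℝ, |r| ≤ C → ∀ s : ℝ, |s| ≤ C → |r * Real.exp s| ≤ C * Real.exp C := by
      intro r hr s hs
      rw [abs_mul, abs_of_pos (Real.exp_pos s)]
      exact mul_le_mul hr (hexp s hs) (Real.exp_pos s).le hC
    have hb0 : ∀ s : ℝ, |s| ≤ C → |Real.exp s| ≤ Real.exp C := by
      intro s hs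
      rw [abs_of_pos (Real.exp_pos s)]; exact hexp s hs
    set D : ℝ := C * Real.exp C + C * Real.exp C + Real.exp C + Real.exp C
    have hbF : ∀ i x, |φ x * Real.exp (φ x) - v i x * Real.exp (φ x) - Real.exp (φ x)
        + Real.exp (v i x)| ≤ D := by
      intro i x
      have h1 := abs_le.1 (hb1 _ (hφC x) _ (hφC x))
      have h2 := abs_le.1 (hb1 _ (hvC i x) _ (hφC x))
      have h3 := abs_le.1 (hb0 _ (hφC x))
      have h4 := abs_le.1 (hb0 _ (hvC i x))
      rw [abs_le]
      constructor <;> simp only [D] <;> linarith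
    have hmF : ∀ i, Measurable fun x => φ x * Real.exp (φ x) - v i x * Real.exp (φ x)
        - Real.exp (φ x) + Real.exp (v i x) := fun i =>
      (((hφ.mul hφ.exp).sub ((hv i).mul hφ.exp)).sub hφ.exp).add (hv i).exp
    have hmφ : Measurable fun x => φ x * Real.exp (φ x) := hφ.mul hφ.exp
    have hbφ : ∀ x, |φ x * Real.exp (φ x)| ≤ C * Real.exp C := fun x => hb1 _ (hφC x) _ (hφC x)
    -- integrability of partial integrals
    have hpart : ∀ (f : (Fin (n + 1) → E) → ℝ), Measurable f → ∀ B, (∀ x, |f x| ≤ B) →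
        Integrable (fun y => ∫ z, f (Fin.cons y z) ∂μ) ν := by
      intro f hf B hB
      have hm : Measurable fun p : E × (Fin n → E) => f (Fin.cons p.1 p.2) :=
        hf.comp measurable_finCons
      exact (integrable_of_measurable_of_abs_le (μ := ν.prod μ) hm B fun _ => hB _).integral_prod_left
    rw [integral_pi_succ ν hmφ _ hbφ, integral_pi_succ ν hφ.exp (Real.exp C)
      (fun x => hb0 _ (hφC x)), Fin.sum_univ_succ]
    change ∫ y, ∫ z, φ (Fin.cons y z) * Real.exp (φ (Fin.cons y z)) ∂μ ∂ν - H * Real.log H ≤ _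
    have hhl_int : Integrable (fun y => h y * Real.log (h y)) ν :=
      integrable_of_measurable_of_abs_le (hhm.mul hhm.log) (Real.exp C * C) fun y => by
        rw [abs_mul]
        exact mul_le_mul (hhabs y) (hlogh y) (abs_nonneg _) (Real.exp_pos _).le
    -- fibrewise induction hypothesis
    have key1 : ∫ y, ∫ z, φ (Fin.cons y z) * Real.exp (φ (Fin.cons y z)) ∂μ ∂ν
        - ∫ y, h y * Real.log (h y) ∂ν ≤
        ∑ i : Fin n, ∫ x, (φ x * Real.exp (φ x) - v i.succ x * Real.exp (φ x) - Real.exp (φ x)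
      + Real.exp (v i.succ x)) ∂(Measure.pi fun _ => ν) := by
      rw [← integral_sub (hpart _ hmφ _ hbφ) hhl_int]
      simp_rw [fun i : Fin n => integral_pi_succ ν (hmF i.succ) _ (hbF i.succ)]
      rw [← integral_finsetSum _ fun (i : Fin n) _ => hpart _ (hmF i.succ) _ (hbF i.succ)]
      refine integral_mono ((hpart _ hmφ _ hbφ).sub hhl_int)
        (integrable_finsetSum _ fun (i : Fin n) _ => hpart _ (hmF i.succ) _ (hbF i.succ)) fun y => ?_
      refine ih (fun z => φ (Fin.cons y z)) (fun i z => v i.succ (Fin.cons y z)) C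
        (hφ.comp (hcons y)) (fun _ => hφC _) (fun i => (hv _).comp (hcons y)) (fun _ _ => hvC _ _) ?_
      intro i x a
      have := hvi i.succ (Fin.cons y x) a
      rw [← Fin.cons_update] at this
      exact this
    -- the first coordinate
    have key2 : ∫ y, h y * Real.log (h y) ∂ν - H * Real.log H ≤
        ∫ x, (φ x * Real.exp (φ x) - v 0 x * Real.exp (φ x) - Real.exp (φ x)
      + Real.exp (v 0 x)) ∂(Measure.pi fun _ => ν) := by
      obtain ⟨y₀⟩ := ν.nonempty_of_neZero
      have hw : ∀ y z, v 0 (Fin.cons y z) = v 0 (Fin.cons y₀ z) := fun y z => by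
        have := hvi 0 (Fin.cons y₀ z) y
        rwa [Fin.update_cons_zero] at this
      set W : ℝ := ∫ z, Real.exp (v 0 (Fin.cons y₀ z)) ∂μ
      have hWint : Integrable (fun z => Real.exp (v 0 (Fin.cons y₀ z))) μ :=
        integrable_of_measurable_of_abs_le ((hv 0).comp (hcons y₀)).exp _ fun z => hb0 _ (hvC _ _)
      have e1 : ∫ y, h y * Real.log (h y) ∂ν - H * Real.log H =
          ∫ y, h y * (Real.log (h y) - Real.log H) - W * (h y / H) + W ∂ν := by
        have i2 : Integrable (fun y => h y * Real.log H) ν := hhint.mul_const _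
        have i3 : Integrable (fun y => W * (h y / H)) ν := (hhint.div_const _).const_mul _
        simp_rw [mul_sub]
        rw [integral_sub_add (f := fun y => h y * Real.log (h y) - h y * Real.log H)
          (hhl_int.sub i2) i3 (integrable_const _), integral_sub hhl_int i2, integral_mul_const,
          integral_const_mul, integral_div]
        simp only [integral_const, probReal_univ, smul_eq_mul, one_mul, ← hH]
        field_simp
        ring
      rw [e1, integral_pi_succ ν (hmF 0) _ (hbF 0)]
      refine integral_mono ?_ (hpart _ (hmF 0) _ (hbF 0)) fun y => ?_
      · have i1 : Integrable (fun y => h y * (Real.log (h y) - Real.log H)) ν := by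
          simp_rw [mul_sub]
          exact hhl_int.sub (hhint.mul_const _)
        exact (i1.sub ((hhint.div_const _).const_mul _)).add (integrable_const _)
      · set r : ℝ := Real.log (h y) - Real.log H with hr
        have hrexp : Real.exp r = h y / H := by
          rw [hr, Real.exp_sub, Real.exp_log (hhp y), Real.exp_log hHp]
        have hFy : Integrable (fun z => φ (Fin.cons y z) * Real.exp (φ (Fin.cons y z))
            - v 0 (Fin.cons y z) * Real.exp (φ (Fin.cons y z)) - Real.exp (φ (Fin.cons y z))
            + Real.exp (v 0 (Fin.cons y z))) μ :=
          integrable_of_measurable_of_abs_le ((hmF 0).comp (hcons y)) D fun z => hbF _ _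
        have e2 : h y * r - W * (h y / H) + W = ∫ z, Real.exp (φ (Fin.cons y z)) * r
            - Real.exp (v 0 (Fin.cons y₀ z)) * (h y / H) + Real.exp (v 0 (Fin.cons y₀ z)) ∂μ := by
          rw [integral_sub_add ((hZint y).mul_const _) (hWint.mul_const _) hWint, integral_mul_const,
            integral_mul_const]
        change h y * r - W * (h y / H) + W ≤ _
        rw [e2]
        refine integral_mono ((((hZint y).mul_const _).sub (hWint.mul_const _)).add hWint) hFy
          fun z => ?_
        simp only
        rw [hw y z, ← hrexp]
        set a := φ (Fin.cons y z)
        set b := v 0 (Fin.cons y₀ z)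
        have h1 : b + r - a + 1 ≤ Real.exp (b + r - a) := Real.add_one_le_exp _
        have h2 : Real.exp a * Real.exp (b + r - a) = Real.exp b * Real.exp r := by
          rw [← Real.exp_add, ← Real.exp_add]; congr 1; ring
        nlinarith [mul_le_mul_of_nonneg_left h1 (Real.exp_pos a).le]
    linarith

/-- Modified logarithmic Sobolev inequality for self-bounding functions. -/
theorem selfBounding_deriv_cgf_le {E : Type*} [MeasurableSpace E] (ν : Measure E)
    [IsProbabilityMeasure ν] {n : ℕ} {Z : (Fin n → E) → ℝ} {Y : Fin n → (Fin n → E) → ℝ} {C : ℝ}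
    (hZ : Measurable Z) (hZC : ∀ x, |Z x| ≤ C) (hY : ∀ i, Measurable (Y i))
    (hYC : ∀ i x, |Y i x| ≤ C) (hYi : ∀ i x y, Y i (Function.update x i y) = Y i x)
    (hdiff : ∀ i x, Z x - Y i x = 0 ∨ Z x - Y i x = 1)
    (hsum : ∀ x, ∑ i, (Z x - Y i x) ≤ Z x) (l : ℝ) :
    (1 - Real.exp (-l)) * ∫ x, Z x * Real.exp (l * Z x) ∂(Measure.pi fun _ => ν) ≤
      (∫ x, Real.exp (l * Z x) ∂(Measure.pi fun _ => ν)) *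
        Real.log (∫ x, Real.exp (l * Z x) ∂(Measure.pi fun _ => ν)) := by
  have hb : ∀ r : ℝ, |r| ≤ C → |l * r| ≤ |l| * C := fun r hr => by
    rw [abs_mul]; exact mul_le_mul_of_nonneg_left hr (abs_nonneg _)
  have hC : 0 ≤ C := by
    obtain ⟨x⟩ := (Measure.pi fun _ : Fin n => ν).nonempty_of_neZero
    exact (abs_nonneg _).trans (hZC x)
  have hent := entropy_pi_le ν n (fun x => l * Z x) (fun i x => l * Y i x) (|l| * C)
    (hZ.const_mul l) (fun x => hb _ (hZC x)) (fun i => (hY i).const_mul l)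
    (fun i x => hb _ (hYC i x)) (fun i x y => by simp only [hYi])
  have hψ : 0 ≤ l - 1 + Real.exp (-l) := by linarith [Real.add_one_le_exp (-l)]
  have hterm : ∀ i x, l * Z x * Real.exp (l * Z x) - l * Y i x * Real.exp (l * Z x)
      - Real.exp (l * Z x) + Real.exp (l * Y i x) =
      (l - 1 + Real.exp (-l)) * ((Z x - Y i x) * Real.exp (l * Z x)) := by
    intro i x
    rcases hdiff i x with h | h
    · have : Y i x = Z x := by linarith
      rw [this]; ring
    · have : Y i x = Z x - 1 := by linarith
      rw [this, show l * (Z x - 1) = -l + l * Z x by ring, Real.exp_add]; ring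
  have hexpb : ∀ x, |Real.exp (l * Z x)| ≤ Real.exp (|l| * C) := fun x => by
    rw [abs_of_pos (Real.exp_pos _)]
    exact Real.exp_le_exp.2 ((le_abs_self _).trans (hb _ (hZC x)))
  have hZint : ∀ i, Integrable (fun x => (Z x - Y i x) * Real.exp (l * Z x))
      (Measure.pi fun _ => ν) := fun i => by
    refine integrable_of_measurable_of_abs_le ((hZ.sub (hY i)).mul (hZ.const_mul l).exp)
      ((C + C) * Real.exp (|l| * C)) fun x => ?_
    rw [abs_mul]
    exact mul_le_mul ((abs_sub _ _).trans (add_le_add (hZC x) (hYC i x))) (hexpb x)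
      (abs_nonneg _) (by linarith)
  have hint2 : Integrable (fun x => Z x * Real.exp (l * Z x)) (Measure.pi fun _ => ν) := by
    refine integrable_of_measurable_of_abs_le (hZ.mul (hZ.const_mul l).exp)
      (C * Real.exp (|l| * C)) fun x => ?_
    rw [abs_mul]
    exact mul_le_mul (hZC x) (hexpb x) (abs_nonneg _) hC
  have hS : ∑ i, ∫ x, (l * Z x * Real.exp (l * Z x) - l * Y i x * Real.exp (l * Z x)
      - Real.exp (l * Z x) + Real.exp (l * Y i x)) ∂(Measure.pi fun _ => ν) ≤
      (l - 1 + Real.exp (-l)) * ∫ x, Z x * Real.exp (l * Z x) ∂(Measure.pi fun _ => ν) := by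
    simp_rw [hterm, integral_const_mul]
    rw [← Finset.mul_sum, ← integral_finsetSum _ fun i _ => hZint i]
    refine mul_le_mul_of_nonneg_left ?_ hψ
    refine integral_mono (integrable_finsetSum _ fun i _ => hZint i) hint2 fun x => ?_
    simp only
    rw [← Finset.sum_mul]
    exact mul_le_mul_of_nonneg_right (hsum x) (Real.exp_pos _).le
  have h1 := hent.trans hS
  simp_rw [mul_assoc, integral_const_mul] at h1
  linarith

theorem div_exp_sub_one_tendsto {G : ℝ → ℝ} {m : ℝ} (hG : HasDerivAt G m 0) (h0 : G 0 = 0) :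
    Tendsto (fun l => G l / (Real.exp l - 1)) (𝓝[≠] 0) (𝓝 m) := by
  have h1 := hasDerivAt_iff_tendsto_slope.1 hG
  have h2 := hasDerivAt_iff_tendsto_slope.1 (Real.hasDerivAt_exp 0)
  have h3 := h1.div h2 (Real.exp_pos 0).ne'
  rw [Real.exp_zero, div_one] at h3
  refine h3.congr' ?_
  filter_upwards [self_mem_nhdsWithin] with l hl
  have hl' : l ≠ 0 := hl
  simp only [Pi.div_apply, slope_def_field, h0, Real.exp_zero, sub_zero]
  field_simp

/-- Integrating the differential inequality `(1 - e^{-l}) G' ≤ G`. -/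
theorem le_exp_sub_one_mul_of_deriv_le {G G' : ℝ → ℝ} (hG : ∀ l, HasDerivAt G (G' l) l)
    (h0 : G 0 = 0) (h : ∀ l, (1 - Real.exp (-l)) * G' l ≤ G l) (l : ℝ) :
    G l ≤ (Real.exp l - 1) * G' 0 := by
  have hlim := div_exp_sub_one_tendsto (hG 0) h0
  have hne : ∀ x : ℝ, x ≠ 0 → Real.exp x - 1 ≠ 0 := fun x hx h => hx (by
    rwa [sub_eq_zero, Real.exp_eq_one_iff] at h)
  have hder : ∀ x : ℝ, x ≠ 0 → HasDerivAt (fun l => G l / (Real.exp l - 1))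
      ((G' x * (Real.exp x - 1) - G x * Real.exp x) / (Real.exp x - 1) ^ 2) x := fun x hx =>
    (hG x).fun_div ((Real.hasDerivAt_exp x).sub_const 1) (hne x hx)
  have hneg : ∀ x : ℝ, (G' x * (Real.exp x - 1) - G x * Real.exp x) / (Real.exp x - 1) ^ 2 ≤ 0 := by
    intro x
    refine div_nonpos_of_nonpos_of_nonneg ?_ (sq_nonneg _)
    have h1 := mul_le_mul_of_nonneg_left (h x) (Real.exp_pos x).le
    have h2 : Real.exp x * Real.exp (-x) = 1 := by rw [← Real.exp_add]; simp
    have h3 : Real.exp x * ((1 - Real.exp (-x)) * G' x) = (Real.exp x - 1) * G' x := by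
      rw [← mul_assoc, mul_sub, h2, mul_one]
    linarith
  have hanti : ∀ D : Set ℝ, Convex ℝ D → IsOpen D → (∀ x ∈ D, x ≠ 0) →
      AntitoneOn (fun l => G l / (Real.exp l - 1)) D := fun D hD hDo h0D => by
    refine antitoneOn_of_deriv_nonpos hD
      (fun x hx => (hder x (h0D x hx)).continuousAt.continuousWithinAt) ?_ ?_
    · rw [hDo.interior_eq]
      exact fun x hx => (hder x (h0D x hx)).differentiableAt.differentiableWithinAt
    · rw [hDo.interior_eq]
      intro x hx
      rw [(hder x (h0D x hx)).deriv]
      exact hneg x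
  rcases lt_trichotomy l 0 with hl | hl | hl
  · have hA := hanti (Iio 0) (convex_Iio 0) isOpen_Iio fun x hx => ne_of_lt hx
    have hT := hlim.mono_left (nhdsWithin_mono (s := Iio 0) 0 fun x hx => ne_of_lt hx)
    have : G' 0 ≤ G l / (Real.exp l - 1) := by
      refine le_of_tendsto hT ?_
      filter_upwards [Ioo_mem_nhdsLT hl] with x hx
      exact hA hl hx.2 hx.1.le
    have hlt : Real.exp l - 1 < 0 := by
      have := Real.exp_lt_one_iff.2 hl; linarith
    rw [le_div_iff_of_neg hlt] at this
    linarith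
  · simp [hl, h0]
  · have hA := hanti (Ioi 0) (convex_Ioi 0) isOpen_Ioi fun x hx => ne_of_gt hx
    have hT := hlim.mono_left (nhdsWithin_mono (s := Ioi 0) 0 fun x hx => ne_of_gt hx)
    have : G l / (Real.exp l - 1) ≤ G' 0 := by
      refine ge_of_tendsto hT ?_
      filter_upwards [Ioo_mem_nhdsGT hl] with x hx
      exact hA hx.1 hl hx.2.le
    have hlt : 0 < Real.exp l - 1 := by
      have := Real.one_lt_exp_iff.2 hl; linarith
    rw [div_le_iff₀ hlt] at this
    linarith

/-- A self-bounding function of independent variables has sub-Poissonian exponential moments. -/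
theorem integral_exp_selfBounding_le {E : Type*} [MeasurableSpace E] (ν : Measure E)
    [IsProbabilityMeasure ν] {n : ℕ} {Z : (Fin n → E) → ℝ} {Y : Fin n → (Fin n → E) → ℝ} {C : ℝ}
    (hZ : Measurable Z) (hZC : ∀ x, |Z x| ≤ C) (hY : ∀ i, Measurable (Y i))
    (hYC : ∀ i x, |Y i x| ≤ C) (hYi : ∀ i x y, Y i (Function.update x i y) = Y i x)
    (hdiff : ∀ i x, Z x - Y i x = 0 ∨ Z x - Y i x = 1)
    (hsum : ∀ x, ∑ i, (Z x - Y i x) ≤ Z x) (l : ℝ) :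
    Integrable (fun x => Real.exp (l * Z x)) (Measure.pi fun _ => ν) ∧
    ∫ x, Real.exp (l * Z x) ∂(Measure.pi fun _ => ν) ≤
      Real.exp ((Real.exp l - 1) * ∫ x, Z x ∂(Measure.pi fun _ => ν)) := by
  set μ : Measure (Fin n → E) := Measure.pi fun _ => ν with hμ
  have hZint : ∀ l, Integrable (fun x => Real.exp (l * Z x)) μ := fun l =>
    integrable_of_measurable_of_abs_le (hZ.const_mul l).exp (Real.exp (|l| * C)) fun x => by
      rw [abs_of_pos (Real.exp_pos _)]
      refine Real.exp_le_exp.2 ((le_abs_self _).trans ?_)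
      rw [abs_mul]; exact mul_le_mul_of_nonneg_left (hZC x) (abs_nonneg _)
  refine ⟨hZint l, ?_⟩
  have huniv : ProbabilityTheory.integrableExpSet Z μ = univ := eq_univ_of_forall hZint
  have hmem : ∀ l, l ∈ interior (ProbabilityTheory.integrableExpSet Z μ) := fun l => by
    simp [huniv]
  have hder : ∀ l, HasDerivAt (fun l => Real.log (∫ x, Real.exp (l * Z x) ∂μ))
      ((∫ x, Z x * Real.exp (l * Z x) ∂μ) / ∫ x, Real.exp (l * Z x) ∂μ) l := fun l =>
    (ProbabilityTheory.hasDerivAt_mgf (hmem l)).log (integral_exp_pos (hZint l)).ne'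
  have hmain := le_exp_sub_one_mul_of_deriv_le hder (by simp) (fun l => by
    rw [← mul_div_assoc, div_le_iff₀ (integral_exp_pos (hZint l)), mul_comm (Real.log _)]
    exact selfBounding_deriv_cgf_le ν hZ hZC hY hYC hYi hdiff hsum l) l
  rw [← Real.log_le_iff_le_exp (integral_exp_pos (hZint l))]
  simpa using hmain

theorem chainLength_bddAbove {d : ℕ} {A : Set (Fin d → ℝ)} (hA : A.Finite) :
    BddAbove {n : ℕ | ∃ C : Finset (Fin d → ℝ),
      ↑C ⊆ A ∧ IsChain (· ≤ ·) (C : Set (Fin d → ℝ)) ∧ C.card = n} := by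
  refine ⟨hA.toFinset.card, ?_⟩
  rintro n ⟨C, hC, -, rfl⟩
  exact Finset.card_le_card fun x hx => hA.mem_toFinset.2 (hC hx)

theorem card_le_chainLength {d : ℕ} {A : Set (Fin d → ℝ)} (hA : A.Finite)
    {C : Finset (Fin d → ℝ)} (hC : ↑C ⊆ A) (hch : IsChain (· ≤ ·) (C : Set (Fin d → ℝ))) :
    C.card ≤ chainLength d A :=
  le_csSup (chainLength_bddAbove hA) ⟨C, hC, hch, rfl⟩

theorem exists_chain_card_eq {d : ℕ} {A : Set (Fin d → ℝ)} (hA : A.Finite) :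
    ∃ C : Finset (Fin d → ℝ), ↑C ⊆ A ∧ IsChain (· ≤ ·) (C : Set (Fin d → ℝ)) ∧
      C.card = chainLength d A := by
  have h := Nat.sSup_mem (s := {n : ℕ | ∃ C : Finset (Fin d → ℝ),
    ↑C ⊆ A ∧ IsChain (· ≤ ·) (C : Set (Fin d → ℝ)) ∧ C.card = n})
    ⟨0, ∅, by simp, by simp, rfl⟩ (chainLength_bddAbove hA)
  exact h

theorem chainLength_mono {d : ℕ} {A B : Set (Fin d → ℝ)} (hB : B.Finite) (hAB : A ⊆ B) :
    chainLength d A ≤ chainLength d B := by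
  obtain ⟨C, hC, hch, hcard⟩ := exists_chain_card_eq (hB.subset hAB)
  rw [← hcard]
  exact card_le_chainLength hB (hC.trans hAB) hch

theorem chainLength_image {d : ℕ} {A : Set (Fin d → ℝ)} (f : (Fin d → ℝ) → Fin d → ℝ)
    (hinj : InjOn f A) (hf : ∀ x ∈ A, ∀ y ∈ A, f x ≤ f y ↔ x ≤ y) :
    chainLength d (f '' A) = chainLength d A := by
  classical
  unfold chainLength
  congr 1
  ext n
  constructor
  · rintro ⟨C, hC, hch, rfl⟩
    obtain ⟨D, hD, hDinj, rfl⟩ := Finset.exists_subset_injOn_image_eq_of_surjOn A (f := f) C hC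
    refine ⟨D, hD, ?_, (Finset.card_image_of_injOn hDinj).symm⟩
    intro x hx y hy hxy
    have := hch (x := f x) (by simpa using ⟨x, hx, rfl⟩) (y := f y) (by simpa using ⟨y, hy, rfl⟩)
      fun h => hxy (hinj (hD hx) (hD hy) h)
    simpa only [hf x (hD hx) y (hD hy), hf y (hD hy) x (hD hx)] using this
  · rintro ⟨C, hC, hch, rfl⟩
    refine ⟨C.image f, ?_, ?_, Finset.card_image_of_injOn (hinj.mono hC)⟩
    · rw [Finset.coe_image]; exact image_mono hC
    · rw [Finset.coe_image]
      rintro _ ⟨x, hx, rfl⟩ _ ⟨y, hy, rfl⟩ hxy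
      have := hch hx hy fun h => hxy (by rw [h])
      simpa only [hf x (hC hx) y (hC hy), hf y (hC hy) x (hC hx)] using this

theorem le_chainLength_image_iff {d n k : ℕ} (T : Set (Fin n)) (X : Fin n → Fin d → ℝ) :
    k ≤ chainLength d (X '' T) ↔ ∃ S : Finset (Fin n), S.card = k ∧ ↑S ⊆ T ∧
      ∀ i ∈ S, ∀ j ∈ S, i ≠ j → X i ≠ X j ∧ (X i ≤ X j ∨ X j ≤ X i) := by
  classical
  have hfin : (X '' T).Finite := (toFinite T).image X
  constructor
  · intro hk
    obtain ⟨C, hC, hch, hcard⟩ := exists_chain_card_eq hfin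
    obtain ⟨C', hC', hcard'⟩ := Finset.exists_subset_card_eq (hcard ▸ hk)
    obtain ⟨S, hS, hSinj, hSC⟩ := Finset.exists_subset_injOn_image_eq_of_surjOn T (f := X) C'
      fun x hx => hC (hC' hx)
    refine ⟨S, by rw [← Finset.card_image_of_injOn hSinj, hSC, hcard'], hS, ?_⟩
    intro i hi j hj hij
    have hne : X i ≠ X j := fun h => hij (hSinj hi hj h)
    refine ⟨hne, hch ?_ ?_ hne⟩
    · exact hC' (hSC ▸ Finset.mem_image_of_mem X hi)
    · exact hC' (hSC ▸ Finset.mem_image_of_mem X hj)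
  · rintro ⟨S, rfl, hST, hS⟩
    have hinj : InjOn X S := fun i hi j hj h => by
      by_contra hij
      exact (hS i hi j hj hij).1 h
    rw [← Finset.card_image_of_injOn hinj]
    refine card_le_chainLength hfin (by rw [Finset.coe_image]; exact image_mono hST) ?_
    rw [Finset.coe_image]
    rintro _ ⟨i, hi, rfl⟩ _ ⟨j, hj, rfl⟩ hij
    exact (hS i hi j hj fun h => hij (by rw [h])).2

theorem measurable_chainLength_image {d n : ℕ} (T : Set (Fin n)) :
    Measurable fun X : Fin n → Fin d → ℝ => chainLength d (X '' T) := by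
  refine measurable_of_Ici fun k => ?_
  have : (fun X : Fin n → Fin d → ℝ => chainLength d (X '' T)) ⁻¹' Ici k =
      ⋃ S : Finset (Fin n), {X | S.card = k ∧ ↑S ⊆ T ∧
        ∀ i ∈ S, ∀ j ∈ S, i ≠ j → X i ≠ X j ∧ (X i ≤ X j ∨ X j ≤ X i)} := by
    ext X
    simp only [mem_preimage, mem_Ici, le_chainLength_image_iff, mem_iUnion, mem_ofPred_eq]
  rw [this]
  refine MeasurableSet.iUnion fun S => ?_
  refine (MeasurableSet.const _).inter ((MeasurableSet.const _).inter ?_)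
  have : {X : Fin n → Fin d → ℝ | ∀ i ∈ S, ∀ j ∈ S, i ≠ j →
      X i ≠ X j ∧ (X i ≤ X j ∨ X j ≤ X i)} = ⋂ i ∈ S, ⋂ j ∈ S, ⋂ _ : i ≠ j,
      {X | X i ≠ X j ∧ (X i ≤ X j ∨ X j ≤ X i)} := by
    ext X; simp
  change MeasurableSet {X : Fin n → Fin d → ℝ | ∀ i ∈ S, ∀ j ∈ S, i ≠ j →
      X i ≠ X j ∧ (X i ≤ X j ∨ X j ≤ X i)}
  rw [this]
  refine Finset.measurableSet_biInter _ fun i _ => Finset.measurableSet_biInter _ fun j _ =>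
    MeasurableSet.iInter fun _ => ?_
  have hc : ∀ i, Continuous fun X : Fin n → Fin d → ℝ => X i := fun i => continuous_apply i
  exact ((isClosed_eq (hc i) (hc j)).measurableSet.compl).inter
    ((isClosed_le (hc i) (hc j)).measurableSet.union (isClosed_le (hc j) (hc i)).measurableSet)

theorem chainLength_image_le {d n : ℕ} (T : Set (Fin n)) (X : Fin n → Fin d → ℝ) :
    chainLength d (X '' T) ≤ n := by
  obtain ⟨S, hS, -⟩ := (le_chainLength_image_iff T X).1 le_rfl
  rw [← hS]
  simpa using Finset.card_le_univ S

theorem chainLength_range_sub {d n : ℕ} (X : Fin n → Fin d → ℝ) (i : Fin n) :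
    chainLength d (X '' univ) = chainLength d (X '' {i}ᶜ) ∨
      chainLength d (X '' univ) = chainLength d (X '' {i}ᶜ) + 1 := by
  classical
  have h1 : chainLength d (X '' {i}ᶜ) ≤ chainLength d (X '' univ) :=
    chainLength_mono ((toFinite univ).image X) (image_mono (subset_univ _))
  have h2 : chainLength d (X '' univ) - 1 ≤ chainLength d (X '' {i}ᶜ) := by
    obtain ⟨S, hS, -, hch⟩ := (le_chainLength_image_iff univ X).1 le_rfl
    refine (Nat.sub_le_sub_right hS.ge 1).trans (Finset.pred_card_le_card_erase (a := i) |>.trans ?_)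
    refine (le_chainLength_image_iff _ X).2 ⟨S.erase i, rfl, ?_, ?_⟩
    · intro j hj
      exact Finset.ne_of_mem_erase hj
    · intro j hj k hk
      exact hch j (Finset.mem_of_mem_erase hj) k (Finset.mem_of_mem_erase hk)
  omega

theorem sum_chainLength_sub_le {d n : ℕ} (X : Fin n → Fin d → ℝ) :
    ∑ i, ((chainLength d (X '' univ) : ℝ) - chainLength d (X '' {i}ᶜ)) ≤
      chainLength d (X '' univ) := by
  classical
  obtain ⟨S, hS, -, hch⟩ := (le_chainLength_image_iff univ X).1 le_rfl
  have hle : ∀ i, ((chainLength d (X '' univ) : ℝ) - chainLength d (X '' {i}ᶜ)) ≤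
      if i ∈ S then 1 else 0 := by
    intro i
    split_ifs with hi
    · rcases chainLength_range_sub X i with h | h <;> rw [h] <;> simp
    · have : chainLength d (X '' univ) ≤ chainLength d (X '' {i}ᶜ) :=
        (le_chainLength_image_iff _ X).2 ⟨S, hS, fun j hj h => hi (h ▸ hj), hch⟩
      rw [sub_nonpos]
      exact_mod_cast this
  refine (Finset.sum_le_sum fun i _ => hle i).trans ?_
  rw [← hS]
  simp

/-- Sub-Poissonian exponential moments of the longest chain among independent points. -/
theorem integral_exp_chainLength_le {d n : ℕ} (ν : Measure (Fin d → ℝ)) [IsProbabilityMeasure ν]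
    (l : ℝ) :
    Integrable (fun X : Fin n → Fin d → ℝ => Real.exp (l * chainLength d (range X)))
      (Measure.pi fun _ => ν) ∧
    ∫ X : Fin n → Fin d → ℝ, Real.exp (l * chainLength d (range X)) ∂(Measure.pi fun _ => ν) ≤
      Real.exp ((Real.exp l - 1) *
        ∫ X : Fin n → Fin d → ℝ, (chainLength d (range X) : ℝ) ∂(Measure.pi fun _ => ν)) := by
  have hm : ∀ T : Set (Fin n),
      Measurable fun X : Fin n → Fin d → ℝ => (chainLength d (X '' T) : ℝ) := fun T =>
    measurable_from_nat.comp (measurable_chainLength_image T)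
  have hb : ∀ (T : Set (Fin n)) (X : Fin n → Fin d → ℝ),
      |(chainLength d (X '' T) : ℝ)| ≤ n := fun T X => by
    rw [Nat.abs_cast]; exact_mod_cast chainLength_image_le T X
  have := integral_exp_selfBounding_le ν (Z := fun X => (chainLength d (X '' univ) : ℝ))
    (Y := fun i X => (chainLength d (X '' {i}ᶜ) : ℝ)) (C := n) (hm univ) (hb univ)
    (fun i => hm _) (fun i => hb _) (fun i X y => by
      congr 2
      exact image_congr fun j hj => Function.update_of_ne hj _ _) (fun i X => by
      rcases chainLength_range_sub X i with h | h <;> rw [h] <;> simp)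
    (fun X => sum_chainLength_sub_le X) l
  simpa only [image_univ] using this

theorem volume_unitCube (d : ℕ) : volume (Icc (0 : Fin d → ℝ) 1) = 1 := by
  simp [Real.volume_Icc_pi]

instance isProbabilityMeasure_unitCube (d : ℕ) :
    IsProbabilityMeasure (volume.restrict (Icc (0 : Fin d → ℝ) 1)) :=
  ⟨by rw [Measure.restrict_apply_univ, volume_unitCube]⟩

/-- The index of the mesh interval of length `1 / M` containing a point of `[0,1]`. -/
def meshIndex (M : ℕ) (a : ℝ) : Fin (M + 1) :=
  ⟨min ⌊(M : ℝ) * a⌋₊ M, Nat.lt_succ_of_le (min_le_right _ _)⟩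

theorem meshIndex_mono (M : ℕ) : Monotone (meshIndex M) := fun a b hab => by
  have : ⌊(M : ℝ) * a⌋₊ ≤ ⌊(M : ℝ) * b⌋₊ :=
    Nat.floor_mono (mul_le_mul_of_nonneg_left hab (Nat.cast_nonneg M))
  exact min_le_min_right M this

theorem measurable_meshIndex (M : ℕ) : Measurable (meshIndex M) := by
  have h : Measurable fun a : ℝ => min ⌊(M : ℝ) * a⌋₊ M :=
    (Nat.measurable_floor.comp (measurable_const_mul (M : ℝ))).min measurable_const
  refine measurable_to_countable' fun v => ?_
  have : meshIndex M ⁻¹' {v} = (fun a : ℝ => min ⌊(M : ℝ) * a⌋₊ M) ⁻¹' {(v : ℕ)} := by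
    ext a
    simp [meshIndex, Fin.ext_iff]
  rw [this]
  exact h (measurableSet_singleton _)

theorem abs_sub_lt_of_meshIndex_eq {M : ℕ} (hM : 0 < M) {a b : ℝ} (ha : a ∈ Icc (0 : ℝ) 1)
    (hb : b ∈ Icc (0 : ℝ) 1) (h : meshIndex M a = meshIndex M b) : |a - b| < 1 / M := by
  have hM' : (0 : ℝ) < M := Nat.cast_pos.2 hM
  have hfl : ∀ x ∈ Icc (0 : ℝ) 1, ⌊(M : ℝ) * x⌋₊ ≤ M := fun x hx => by
    refine Nat.floor_le_of_le ?_
    nlinarith [hx.2]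
  have h' : ⌊(M : ℝ) * a⌋₊ = ⌊(M : ℝ) * b⌋₊ := by
    have := congrArg Fin.val h
    simpa only [meshIndex, min_eq_left (hfl a ha), min_eq_left (hfl b hb)] using this
  have a1 := Nat.floor_le (mul_nonneg hM'.le ha.1)
  have a2 := Nat.lt_floor_add_one ((M : ℝ) * a)
  have b1 := Nat.floor_le (mul_nonneg hM'.le hb.1)
  have b2 := Nat.lt_floor_add_one ((M : ℝ) * b)
  rw [h'] at a1 a2
  rw [lt_div_iff₀ hM', ← abs_of_pos hM', ← abs_mul, abs_lt]
  constructor <;> nlinarith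

/-- The mesh cell of a point of `ℝ^d`. -/
def meshCell (d M : ℕ) (x : Fin d → ℝ) : Fin d → Fin (M + 1) := fun i => meshIndex M (x i)

/-- The part of the unit cube with a given mesh cell. -/
def cubeCell (d M : ℕ) (v : Fin d → Fin (M + 1)) : Set (Fin d → ℝ) :=
  Icc 0 1 ∩ meshCell d M ⁻¹' {v}

theorem measurableSet_cubeCell (d M : ℕ) (v : Fin d → Fin (M + 1)) :
    MeasurableSet (cubeCell d M v) := by
  have : Measurable (meshCell d M) :=
    measurable_pi_iff.2 fun i => (measurable_meshIndex M).comp (measurable_pi_apply i)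
  exact measurableSet_Icc.inter (this (measurableSet_singleton v))

theorem isBounded_cubeCell (d M : ℕ) (v : Fin d → Fin (M + 1)) :
    Bornology.IsBounded (cubeCell d M v) :=
  (Metric.isBounded_Icc 0 1).subset inter_subset_left

theorem disjoint_cubeCell {d M : ℕ} {v w : Fin d → Fin (M + 1)} (h : v ≠ w) :
    Disjoint (cubeCell d M v) (cubeCell d M w) :=
  Set.disjoint_left.2 fun _ hx hy => h (hx.2.symm.trans hy.2)

theorem sum_volume_cubeCell (d M : ℕ) : ∑ v, volume (cubeCell d M v) = 1 := by
  rw [← volume_unitCube d]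
  have : Icc (0 : Fin d → ℝ) 1 = ⋃ v, cubeCell d M v := by
    ext x; simp [cubeCell]
  rw [this, measure_iUnion (fun v w h => disjoint_cubeCell h) (measurableSet_cubeCell d M),
    tsum_fintype]

/-- Cells of a configuration in which no two distinct cells share a coordinate slab. -/
def TieFree {d M : ℕ} (S : Finset (Fin d → Fin (M + 1))) : Prop :=
  ∀ v ∈ S, ∀ w ∈ S, v ≠ w → ∀ i, v i ≠ w i

/-- Longest chain of a set of mesh cells. -/
def meshChainLength {d M : ℕ} (S : Finset (Fin d → Fin (M + 1))) : ℕ :=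
  chainLength d ((fun v i => ((v i : ℕ) : ℝ)) '' (S : Set (Fin d → Fin (M + 1))))

theorem chainLength_eq_meshChainLength {d M : ℕ} {A : Set (Fin d → ℝ)}
    {S : Finset (Fin d → Fin (M + 1))} (hS : TieFree S) (hinj : InjOn (meshCell d M) A)
    (him : meshCell d M '' A = S) : chainLength d A = meshChainLength S := by
  have hcast : Function.Injective fun (v : Fin d → Fin (M + 1)) i => ((v i : ℕ) : ℝ) := by
    intro v w h
    funext i
    have : ((v i : ℕ) : ℝ) = ((w i : ℕ) : ℝ) := congrFun h i
    exact Fin.ext (by exact_mod_cast this)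
  rw [meshChainLength, ← him, ← image_comp]
  refine (chainLength_image _ (hcast.comp_injOn hinj) fun x hx y hy =>
    ⟨fun h i => ?_, fun h i => ?_⟩).symm
  · by_cases hxy : x = y
    · rw [hxy]
    · by_contra hlt
      have h1 : meshCell d M y i ≤ meshCell d M x i := meshIndex_mono M (not_le.1 hlt).le
      have h2 : meshCell d M x i ≤ meshCell d M y i := by
        have := h i
        simp only [Function.comp] at this
        exact_mod_cast this
      refine hS _ (by rw [← Finset.mem_coe, ← him]; exact mem_image_of_mem _ hx) _
        (by rw [← Finset.mem_coe, ← him]; exact mem_image_of_mem _ hy)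
        (fun h => hxy (hinj hx hy h)) i (le_antisymm h2 h1)
  · have : meshCell d M x i ≤ meshCell d M y i := meshIndex_mono M (h i)
    simp only [Function.comp]
    exact_mod_cast this

/-- Configurations of `n` points occupying each cell of `S` exactly once. -/
def cellOccupation {d M : ℕ} (n : ℕ) (S : Finset (Fin d → Fin (M + 1))) :
    Set (Fin n → Fin d → ℝ) :=
  ⋃ σ : Fin n ≃ S, Set.pi univ fun i => cubeCell d M (σ i)

theorem mem_cellOccupation {d M n : ℕ} {S : Finset (Fin d → Fin (M + 1))}
    {X : Fin n → Fin d → ℝ} :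
    X ∈ cellOccupation n S ↔ ∃ σ : Fin n ≃ S, ∀ i, X i ∈ cubeCell d M (σ i) := by
  simp [cellOccupation]

theorem measurableSet_cellOccupation {d M : ℕ} (n : ℕ) (S : Finset (Fin d → Fin (M + 1))) :
    MeasurableSet (cellOccupation n S) :=
  MeasurableSet.iUnion fun _ => MeasurableSet.univ_pi fun _ => measurableSet_cubeCell d M _

theorem cellOccupation_image {d M n : ℕ} {S : Finset (Fin d → Fin (M + 1))}
    {X : Fin n → Fin d → ℝ} (hX : X ∈ cellOccupation n S) :
    InjOn (meshCell d M) (range X) ∧ meshCell d M '' range X = S := by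
  obtain ⟨σ, hσ⟩ := mem_cellOccupation.1 hX
  have hv : ∀ i, meshCell d M (X i) = σ i := fun i => (hσ i).2
  constructor
  · rintro _ ⟨i, rfl⟩ _ ⟨j, rfl⟩ h
    rw [hv, hv] at h
    rw [σ.injective (Subtype.ext h)]
  · ext w
    constructor
    · rintro ⟨_, ⟨i, rfl⟩, rfl⟩
      rw [hv]
      exact (σ i).2
    · intro hw
      obtain ⟨i, hi⟩ := σ.surjective ⟨w, hw⟩
      exact ⟨X i, ⟨i, rfl⟩, by rw [hv, hi]⟩

theorem measure_cellOccupation {d M n : ℕ} {S : Finset (Fin d → Fin (M + 1))} (hS : S.card = n) :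
    (Measure.pi fun _ : Fin n => volume.restrict (Icc (0 : Fin d → ℝ) 1)) (cellOccupation n S) =
      n.factorial * ∏ v ∈ S, volume (cubeCell d M v) := by
  have hcell : ∀ v, volume.restrict (Icc (0 : Fin d → ℝ) 1) (cubeCell d M v) =
      volume (cubeCell d M v) := fun v => by
    rw [Measure.restrict_apply (measurableSet_cubeCell d M v),
      inter_eq_left.2 (show cubeCell d M v ⊆ Icc 0 1 from inter_subset_left)]
  rw [cellOccupation, measure_iUnion]
  · simp_rw [Measure.pi_pi, hcell]
    have : ∀ σ : Fin n ≃ S, ∏ i, volume (cubeCell d M (σ i)) = ∏ v ∈ S, volume (cubeCell d M v) :=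
      fun σ => by
        rw [σ.prod_comp (fun v : S => volume (cubeCell d M v)), Finset.prod_coe_sort S
          fun v => volume (cubeCell d M v)]
    simp_rw [this]
    rw [tsum_fintype, Finset.sum_const, Finset.card_univ,
      Fintype.card_equiv (Fintype.equivOfCardEq (by simp [hS])), Fintype.card_fin, nsmul_eq_mul]
  · intro σ τ hστ
    refine Set.disjoint_left.2 fun X hX hY => hστ ?_
    ext i : 2
    exact ((hX i trivial).2.symm.trans (hY i trivial).2)
  · exact fun σ => MeasurableSet.univ_pi fun _ => measurableSet_cubeCell d M _

/-- The Poisson weight `e^{-t} t^n / n!`. -/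
def poissonWeight (t : ℝ) (n : ℕ) : ENNReal :=
  ENNReal.ofReal (Real.exp (-t) * t ^ n / n.factorial)

theorem hasSum_poissonWeight_real (t : ℝ) (a : ℝ) :
    HasSum (fun n : ℕ => Real.exp (-t) * t ^ n / n.factorial * Real.exp (a * n))
      (Real.exp (-t) * Real.exp (t * Real.exp a)) := by
  have h := (NormedSpace.expSeries_div_hasSum_exp (t * Real.exp a)).mul_left (Real.exp (-t))
  rw [← Real.exp_eq_exp_ℝ] at h
  refine (funext fun n => ?_ : _ = fun n : ℕ => _) ▸ h
  rw [mul_pow, ← Real.exp_nat_mul, mul_comm a]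
  ring

theorem tsum_poissonWeight_mul_exp {t : ℝ} (ht : 0 ≤ t) (a : ℝ) :
    ∑' n, poissonWeight t n * ENNReal.ofReal (Real.exp (a * n)) =
      ENNReal.ofReal (Real.exp (t * (Real.exp a - 1))) := by
  have h := hasSum_poissonWeight_real t a
  have h0 : ∀ n : ℕ, 0 ≤ Real.exp (-t) * t ^ n / n.factorial := fun n => by positivity
  rw [show t * (Real.exp a - 1) = -t + t * Real.exp a by ring, Real.exp_add, ← h.tsum_eq,
    ENNReal.ofReal_tsum_of_nonneg (fun n => mul_nonneg (h0 n) (Real.exp_pos _).le) h.summable]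
  exact tsum_congr fun n => (ENNReal.ofReal_mul (h0 n)).symm

theorem tsum_poissonWeight {t : ℝ} (ht : 0 ≤ t) : ∑' n, poissonWeight t n = 1 := by
  simpa using tsum_poissonWeight_mul_exp ht 0

theorem tsum_poissonWeight_mul_sq_ne_top {t : ℝ} (ht : 0 ≤ t) :
    ∑' n : ℕ, poissonWeight t n * (n : ENNReal) ^ 2 ≠ ⊤ := by
  have hle : ∀ n : ℕ, (n : ENNReal) ^ 2 ≤ ENNReal.ofReal (Real.exp (2 * n)) := fun n => by
    rw [← ENNReal.ofReal_natCast, ← ENNReal.ofReal_pow (Nat.cast_nonneg n)]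
    refine ENNReal.ofReal_le_ofReal ?_
    rw [two_mul, Real.exp_add, ← sq]
    exact pow_le_pow_left₀ (Nat.cast_nonneg n)
      (by linarith [Real.add_one_le_exp (n : ℝ)]) 2
  refine ne_top_of_le_ne_top ?_ (ENNReal.tsum_le_tsum fun n => mul_le_mul_right (hle n) _)
  rw [tsum_poissonWeight_mul_exp ht]
  exact ENNReal.ofReal_ne_top

section PoissonProcess

variable {d : ℕ} {Ω : Type*} [MeasurableSpace Ω] {P : Measure Ω} {t : ℝ}

/-- The event that each cell of `S` holds exactly one point and the other cells none. -/
def cellEvent (N : PoissonPP d P fun _ => t) {M : ℕ} (S : Finset (Fin d → Fin (M + 1))) :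
    Set Ω :=
  ⋂ v, {ω | (N.pts ω ∩ cubeCell d M v).encard = ((if v ∈ S then 1 else 0 : ℕ) : ℕ∞)}

theorem measurableSet_cellEvent (N : PoissonPP d P fun _ => t) {M : ℕ}
    (S : Finset (Fin d → Fin (M + 1))) : MeasurableSet (cellEvent N S) :=
  MeasurableSet.iInter fun v =>
    N.measur _ (measurableSet_cubeCell d M v) (isBounded_cubeCell d M v) _

theorem disjoint_cellEvent (N : PoissonPP d P fun _ => t) {M : ℕ}
    {S T : Finset (Fin d → Fin (M + 1))} (h : S ≠ T) :
    Disjoint (cellEvent N S) (cellEvent N T) := by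
  refine Set.disjoint_left.2 fun ω hS hT => h ?_
  ext v
  have h1 := mem_iInter.1 hS v
  have h2 := mem_iInter.1 hT v
  simp only [mem_ofPred_eq] at h1 h2
  rw [h1, Nat.cast_inj] at h2
  by_cases a : v ∈ S <;> by_cases b : v ∈ T <;> simp [a, b] at h2 ⊢

theorem measure_cellEvent (ht : 0 ≤ t) (N : PoissonPP d P fun _ => t) {M n : ℕ}
    {S : Finset (Fin d → Fin (M + 1))} (hS : S.card = n) :
    P (cellEvent N S) = poissonWeight t n *
      (Measure.pi fun _ : Fin n => volume.restrict (Icc (0 : Fin d → ℝ) 1))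
        (cellOccupation n S) := by
  let e := Fintype.equivFin (Fin d → Fin (M + 1))
  set k : (Fin d → Fin (M + 1)) → ℕ := fun v => if v ∈ S then 1 else 0 with hk
  have hfin : ∀ v, volume (cubeCell d M v) ≠ ⊤ := fun v =>
    (isBounded_cubeCell d M v).measure_lt_top.ne
  set a : (Fin d → Fin (M + 1)) → ℝ := fun v => (volume (cubeCell d M v)).toReal with ha
  have ha0 : ∀ v, 0 ≤ a v := fun v => ENNReal.toReal_nonneg
  have hasum : ∑ v, a v = 1 := by
    rw [← ENNReal.toReal_sum fun v _ => hfin v, sum_volume_cubeCell, ENNReal.toReal_one]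
  have hprod : P (cellEvent N S) =
      ∏ v, P {ω | (N.pts ω ∩ cubeCell d M v).encard = (k v : ℕ∞)} := by
    have h := N.indep _ (fun i => cubeCell d M (e.symm i))
      (fun i => measurableSet_cubeCell d M _) (fun i => isBounded_cubeCell d M _)
      (fun i j hij => disjoint_cubeCell fun h => hij (e.symm.injective h)) fun i => k (e.symm i)
    rw [e.symm.prod_comp fun v => P {ω | (N.pts ω ∩ cubeCell d M v).encard = (k v : ℕ∞)},
      e.symm.surjective.iInter_comp
        fun v => {ω | (N.pts ω ∩ cubeCell d M v).encard = (k v : ℕ∞)}] at h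
    exact h
  have hone : ∀ v, P {ω | (N.pts ω ∩ cubeCell d M v).encard = (k v : ℕ∞)} =
      ENNReal.ofReal (Real.exp (-(t * a v)) * if v ∈ S then t * a v else 1) := fun v => by
    rw [N.poisson _ (measurableSet_cubeCell d M v) (isBounded_cubeCell d M v)]
    have : ∫ _ in cubeCell d M v, t = t * a v := by
      rw [setIntegral_const, smul_eq_mul, mul_comm]; rfl
    rw [this]
    by_cases hv : v ∈ S <;> simp [hk, hv]
  rw [hprod, measure_cellOccupation hS]
  simp_rw [hone]
  rw [← ENNReal.ofReal_prod_of_nonneg fun v _ => mul_nonneg (Real.exp_pos _).le (by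
    split_ifs <;> [exact mul_nonneg ht (ha0 v); exact zero_le_one])]
  rw [Finset.prod_mul_distrib, ← Real.exp_sum, Finset.sum_neg_distrib, ← Finset.mul_sum, hasum,
    mul_one, Finset.prod_ite_mem, Finset.univ_inter, Finset.prod_mul_distrib, Finset.prod_const, hS]
  have hvol : ∏ v ∈ S, volume (cubeCell d M v) = ENNReal.ofReal (∏ v ∈ S, a v) := by
    rw [ENNReal.ofReal_prod_of_nonneg fun v _ => ha0 v]
    exact Finset.prod_congr rfl fun v _ => (ENNReal.ofReal_toReal (hfin v)).symm
  rw [hvol, poissonWeight, ← ENNReal.ofReal_natCast n.factorial,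
    ← ENNReal.ofReal_mul (Nat.cast_nonneg _), ← ENNReal.ofReal_mul (by positivity)]
  congr 1
  have : (n.factorial : ℝ) ≠ 0 := by positivity
  field_simp

theorem cellEvent_image {N : PoissonPP d P fun _ => t} {M : ℕ}
    {S : Finset (Fin d → Fin (M + 1))} {ω : Ω} (hω : ω ∈ cellEvent N S) :
    InjOn (meshCell d M) (N.pts ω ∩ Icc 0 1) ∧ meshCell d M '' (N.pts ω ∩ Icc 0 1) = S := by
  have hv : ∀ v, (N.pts ω ∩ cubeCell d M v).encard = ((if v ∈ S then 1 else 0 : ℕ) : ℕ∞) :=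
    fun v => mem_iInter.1 hω v
  have hmem : ∀ x ∈ N.pts ω ∩ Icc 0 1, x ∈ N.pts ω ∩ cubeCell d M (meshCell d M x) :=
    fun x hx => ⟨hx.1, hx.2, rfl⟩
  constructor
  · intro x hx y hy hxy
    have hle : (N.pts ω ∩ cubeCell d M (meshCell d M x)).encard ≤ 1 := by
      rw [hv]; split_ifs <;> simp
    exact encard_le_one_iff.1 hle x y (hmem x hx) (hxy ▸ hmem y hy)
  · ext v
    constructor
    · rintro ⟨x, hx, rfl⟩
      by_contra hS
      have h := hv (meshCell d M x)
      rw [if_neg (fun h => hS (Finset.mem_coe.2 h)), Nat.cast_zero, encard_eq_zero] at h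
      exact (h ▸ hmem x hx : x ∈ (∅ : Set _))
    · intro hS
      have h := hv v
      rw [if_pos (Finset.mem_coe.1 hS), Nat.cast_one, encard_eq_one] at h
      obtain ⟨x, hx⟩ := h
      have hx' : x ∈ N.pts ω ∩ cubeCell d M v := by rw [hx]; rfl
      exact ⟨x, ⟨hx'.1, hx'.2.1⟩, hx'.2.2⟩

/-- Occupation events have the same law under the Poisson process and under a Poisson number of
independent uniform points. -/
theorem measure_biUnion_cellEvent (ht : 0 ≤ t) (N : PoissonPP d P fun _ => t) {M : ℕ}
    (𝒯 : Finset (Finset (Fin d → Fin (M + 1)))) :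
    P (⋃ S ∈ 𝒯, cellEvent N S) = ∑' n, poissonWeight t n *
      (Measure.pi fun _ : Fin n => volume.restrict (Icc (0 : Fin d → ℝ) 1))
        (⋃ S ∈ 𝒯.filter fun S => S.card = n, cellOccupation n S) := by
  rw [measure_biUnion_finset (fun S _ T _ h => disjoint_cellEvent N h)
    fun S _ => measurableSet_cellEvent N S]
  have hU : ∀ n : ℕ, (Measure.pi fun _ : Fin n => volume.restrict (Icc (0 : Fin d → ℝ) 1))
        (⋃ S ∈ 𝒯.filter fun S => S.card = n, cellOccupation n S) =
      ∑ S ∈ 𝒯, if S.card = n then (Measure.pi fun _ : Fin n =>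
        volume.restrict (Icc (0 : Fin d → ℝ) 1)) (cellOccupation n S) else 0 := fun n => by
    rw [measure_biUnion_finset _ fun S _ => measurableSet_cellOccupation n S, Finset.sum_filter]
    intro S _ T _ h
    refine Set.disjoint_left.2 fun X hX hY => h ?_
    exact Finset.coe_injective ((cellOccupation_image hX).2.symm.trans (cellOccupation_image hY).2)
  simp_rw [hU, Finset.mul_sum]
  rw [Summable.tsum_finsetSum fun _ _ => ENNReal.summable]
  refine Finset.sum_congr rfl fun S _ => ?_
  rw [tsum_eq_single S.card fun n hn => by rw [if_neg hn.symm, mul_zero], if_pos rfl,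
    measure_cellEvent ht N rfl]

end PoissonProcess

theorem measure_unitCube_slab_le (d : ℕ) (k : Fin d) (a δ : ℝ) :
    volume.restrict (Icc (0 : Fin d → ℝ) 1) {y | |a - y k| < δ} ≤ ENNReal.ofReal (2 * δ) := by
  rw [Measure.restrict_apply' measurableSet_Icc]
  let s : Fin d → Set ℝ := fun i => if i = k then Ioo (a - δ) (a + δ) else Icc 0 1
  have hsub : {y : Fin d → ℝ | |a - y k| < δ} ∩ Icc 0 1 ⊆ Set.pi univ s := by
    rintro y ⟨hy, hy'⟩ i -
    by_cases hi : i = k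
    · have := abs_lt.1 (show |a - y k| < δ from hy)
      subst hi
      simp only [s, if_pos]
      constructor <;> linarith
    · simp only [s, if_neg hi]
      exact ⟨hy'.1 i, hy'.2 i⟩
  refine (measure_mono hsub).trans ?_
  rw [volume_pi_pi, Finset.prod_eq_single k]
  · simp only [s, if_pos, Real.volume_Ioo]
    exact ENNReal.ofReal_le_ofReal (by linarith)
  · intro i _ hi
    simp [s, if_neg hi]
  · simp

theorem measure_pi_slab_le {d n : ℕ} {i j : Fin n} (hij : i ≠ j) (k : Fin d) (δ : ℝ) :
    (Measure.pi fun _ : Fin n => volume.restrict (Icc (0 : Fin d → ℝ) 1))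
      {X | |X i k - X j k| < δ} ≤ ENNReal.ofReal (2 * δ) := by
  set ν := volume.restrict (Icc (0 : Fin d → ℝ) 1)
  have hind : ProbabilityTheory.IndepFun (fun X : Fin n → Fin d → ℝ => X i) (fun X => X j)
      (Measure.pi fun _ : Fin n => ν) :=
    (ProbabilityTheory.iIndepFun_pi (μ := fun _ : Fin n => ν) (X := fun _ x => x)
      fun _ => aemeasurable_id).indepFun hij
  have hmap : ∀ l : Fin n, Measure.map (fun X : Fin n → Fin d → ℝ => X l)
      (Measure.pi fun _ : Fin n => ν) = ν := fun l =>
    (measurePreserving_eval (fun _ : Fin n => ν) l).map_eq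
  rw [ProbabilityTheory.indepFun_iff_map_prod_eq_prod_map_map
    (measurable_pi_apply i).aemeasurable (measurable_pi_apply j).aemeasurable, hmap, hmap] at hind
  have hs : MeasurableSet {p : (Fin d → ℝ) × (Fin d → ℝ) | |p.1 k - p.2 k| < δ} :=
    measurableSet_lt (by fun_prop) measurable_const
  have hpre : {X : Fin n → Fin d → ℝ | |X i k - X j k| < δ} =
      (fun X => (X i, X j)) ⁻¹' {p : (Fin d → ℝ) × (Fin d → ℝ) | |p.1 k - p.2 k| < δ} := rfl
  rw [hpre, ← Measure.map_apply (by fun_prop) hs, hind, Measure.prod_apply hs]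
  refine (lintegral_mono fun x : Fin d → ℝ => measure_unitCube_slab_le d k (x k) δ).trans ?_
  rw [lintegral_const, measure_univ, mul_one]

/-- Tie-free occupation events cover all configurations up to small probability. -/
theorem measure_compl_tieFree_le {d M n : ℕ} (hd : 0 < d) (hM : 0 < M)
    {𝒯 : Finset (Finset (Fin d → Fin (M + 1)))} (h𝒯 : ∀ S, TieFree S → S ∈ 𝒯) :
    (Measure.pi fun _ : Fin n => volume.restrict (Icc (0 : Fin d → ℝ) 1))
      (⋃ S ∈ 𝒯.filter fun S => S.card = n, cellOccupation n S)ᶜ ≤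
        (n : ENNReal) ^ 2 * (d * ENNReal.ofReal (2 * (1 / M))) := by
  classical
  set μ := Measure.pi fun _ : Fin n => volume.restrict (Icc (0 : Fin d → ℝ) 1)
  have hnull : μ (Set.pi univ fun _ : Fin n => Icc (0 : Fin d → ℝ) 1)ᶜ = 0 := by
    rw [prob_compl_eq_zero_iff (MeasurableSet.univ_pi fun _ => measurableSet_Icc), Measure.pi_pi]
    simp [volume_unitCube]
  let bad : Fin n × Fin n → Fin d → Set (Fin n → Fin d → ℝ) := fun p k =>
    if p.1 = p.2 then ∅ else {X | |X p.1 k - X p.2 k| < 1 / M}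
  have hsub : (⋃ S ∈ 𝒯.filter fun S => S.card = n, cellOccupation n S)ᶜ ⊆
      (Set.pi univ fun _ : Fin n => Icc (0 : Fin d → ℝ) 1)ᶜ ∪ ⋃ p, ⋃ k, bad p k := by
    intro X hX
    by_contra hgood
    rw [mem_union, not_or, notMem_compl_iff] at hgood
    obtain ⟨hcube, hbad⟩ := hgood
    have hne : ∀ i j, i ≠ j → ∀ k, meshCell d M (X i) k ≠ meshCell d M (X j) k := by
      intro i j hij k h
      refine hbad (mem_iUnion₂.2 ⟨(i, j), k, ?_⟩)
      simp only [bad, if_neg hij]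
      exact abs_sub_lt_of_meshIndex_eq hM ⟨(hcube i trivial).1 k, (hcube i trivial).2 k⟩
        ⟨(hcube j trivial).1 k, (hcube j trivial).2 k⟩ h
    have hinj : Function.Injective fun i => meshCell d M (X i) := fun i j h => by
      by_contra hij
      exact hne i j hij ⟨0, hd⟩ (congrFun h _)
    let S := Finset.univ.image fun i => meshCell d M (X i)
    have hS : TieFree S := by
      intro v hv w hw hvw k
      obtain ⟨i, -, rfl⟩ := Finset.mem_image.1 hv
      obtain ⟨j, -, rfl⟩ := Finset.mem_image.1 hw
      exact hne i j (fun h => hvw (by rw [h])) k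
    refine hX (mem_iUnion₂.2 ⟨S, Finset.mem_filter.2 ⟨h𝒯 S hS, ?_⟩, ?_⟩)
    · rw [Finset.card_image_of_injective _ hinj, Finset.card_univ, Fintype.card_fin]
    · refine mem_cellOccupation.2 ⟨Equiv.ofBijective
        (fun i => ⟨meshCell d M (X i), Finset.mem_image_of_mem _ (Finset.mem_univ i)⟩)
        ⟨fun i j h => hinj (congrArg Subtype.val h), ?_⟩, fun i => ⟨hcube i trivial, rfl⟩⟩
      rintro ⟨v, hv⟩
      obtain ⟨i, -, rfl⟩ := Finset.mem_image.1 hv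
      exact ⟨i, rfl⟩
  have hbad : ∀ p k, μ (bad p k) ≤ ENNReal.ofReal (2 * (1 / M)) := fun p k => by
    by_cases hp : p.1 = p.2
    · simp [bad, if_pos hp]
    · simp only [bad, if_neg hp]
      exact measure_pi_slab_le hp k _
  calc μ _ ≤ μ (Set.pi univ fun _ : Fin n => Icc (0 : Fin d → ℝ) 1)ᶜ +
        μ (⋃ p, ⋃ k, bad p k) := (measure_mono hsub).trans (measure_union_le _ _)
    _ ≤ 0 + ∑ p : Fin n × Fin n, ∑ k : Fin d, ENNReal.ofReal (2 * (1 / M)) := by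
        rw [hnull]
        gcongr
        refine (measure_iUnion_fintype_le _ _).trans (Finset.sum_le_sum fun p _ => ?_)
        exact (measure_iUnion_fintype_le _ _).trans (Finset.sum_le_sum fun k _ => hbad p k)
    _ = _ := by simp [sq]

/-- Events on the chain length are at most as likely for the Poisson process as for a Poisson number
of independent uniform points. -/
theorem measure_chainLength_mem_le {d : ℕ} (hd : 0 < d) {Ω : Type*} [MeasurableSpace Ω]
    {P : Measure Ω} [IsProbabilityMeasure P] {t : ℝ} (ht : 0 ≤ t) (N : PoissonPP d P fun _ => t)
    (B : Set ℕ) :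
    P {ω | chainLength d (N.pts ω ∩ Icc 0 1) ∈ B} ≤ ∑' n, poissonWeight t n *
      (Measure.pi fun _ : Fin n => volume.restrict (Icc (0 : Fin d → ℝ) 1))
        {X | chainLength d (range X) ∈ B} := by
  classical
  let μ : ∀ n : ℕ, Measure (Fin n → Fin d → ℝ) := fun n =>
    Measure.pi fun _ : Fin n => volume.restrict (Icc (0 : Fin d → ℝ) 1)
  set R := ∑' n, poissonWeight t n * μ n {X | chainLength d (range X) ∈ B} with hR
  set K := ∑' n : ℕ, poissonWeight t n * (n : ENNReal) ^ 2 with hK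
  have hKtop : K ≠ ⊤ := tsum_poissonWeight_mul_sq_ne_top ht
  have hbound : ∀ M : ℕ, 0 < M →
      P {ω | chainLength d (N.pts ω ∩ Icc 0 1) ∈ B} ≤
        R + K * (d * ENNReal.ofReal (2 * (1 / M))) := by
    intro M hM
    let 𝒯 : Finset (Finset (Fin d → Fin (M + 1))) := Finset.univ.filter TieFree
    let ℬ := 𝒯.filter fun S => meshChainLength S ∈ B
    let V : ∀ n : ℕ, Set (Fin n → Fin d → ℝ) := fun n =>
      ⋃ S ∈ 𝒯.filter fun S => S.card = n, cellOccupation n S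
    have hVmeas : ∀ n, MeasurableSet (V n) := fun n =>
      Finset.measurableSet_biUnion _ fun S _ => measurableSet_cellOccupation n S
    have hUmeas : MeasurableSet (⋃ S ∈ 𝒯, cellEvent N S) :=
      Finset.measurableSet_biUnion _ fun S _ => measurableSet_cellEvent N S
    have hfirst : P (⋃ S ∈ ℬ, cellEvent N S) ≤ R := by
      rw [measure_biUnion_cellEvent ht N ℬ]
      refine ENNReal.tsum_le_tsum fun n => mul_le_mul_right (measure_mono ?_) _
      intro X hX
      obtain ⟨S, hS, hXS⟩ := mem_iUnion₂.1 hX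
      have hSB := Finset.mem_filter.1 (Finset.mem_filter.1 hS).1
      have hST := (Finset.mem_filter.1 hSB.1).2
      obtain ⟨h1, h2⟩ := cellOccupation_image hXS
      show chainLength d (range X) ∈ B
      rw [chainLength_eq_meshChainLength hST h1 h2]
      exact hSB.2
    have hsecond : P (⋃ S ∈ 𝒯, cellEvent N S)ᶜ ≤ ∑' n, poissonWeight t n * μ n (V n)ᶜ := by
      have hsum : ∑' n, poissonWeight t n * μ n (V n) + ∑' n, poissonWeight t n * μ n (V n)ᶜ
          = 1 := by
        rw [← ENNReal.tsum_add, ← tsum_poissonWeight ht]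
        refine tsum_congr fun n => ?_
        rw [← mul_add, measure_add_measure_compl (hVmeas n), measure_univ, mul_one]
      rw [prob_compl_eq_one_sub hUmeas, measure_biUnion_cellEvent ht N 𝒯, ← hsum]
      exact (ENNReal.add_sub_cancel_left (ne_top_of_le_ne_top ENNReal.one_ne_top
        (hsum ▸ le_self_add))).le
    have hsub : {ω | chainLength d (N.pts ω ∩ Icc 0 1) ∈ B} ⊆
        (⋃ S ∈ ℬ, cellEvent N S) ∪ (⋃ S ∈ 𝒯, cellEvent N S)ᶜ := by
      intro ω hω
      by_cases h : ω ∈ ⋃ S ∈ 𝒯, cellEvent N S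
      · left
        obtain ⟨S, hS, hωS⟩ := mem_iUnion₂.1 h
        obtain ⟨h1, h2⟩ := cellEvent_image hωS
        refine mem_iUnion₂.2 ⟨S, Finset.mem_filter.2 ⟨hS, ?_⟩, hωS⟩
        rw [← chainLength_eq_meshChainLength (Finset.mem_filter.1 hS).2 h1 h2]
        exact hω
      · exact Or.inr h
    refine ((measure_mono hsub).trans (measure_union_le _ _)).trans (add_le_add hfirst ?_)
    refine hsecond.trans ?_
    rw [hK, ← ENNReal.tsum_mul_right]
    refine ENNReal.tsum_le_tsum fun n => ?_
    rw [mul_assoc]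
    exact mul_le_mul_right (measure_compl_tieFree_le hd hM fun S hS =>
      Finset.mem_filter.2 ⟨Finset.mem_univ S, hS⟩) _
  have hlim : Tendsto (fun M : ℕ => R + K * (d * ENNReal.ofReal (2 * (1 / M)))) atTop (𝓝 R) := by
    have h1 : Tendsto (fun M : ℕ => ENNReal.ofReal (2 * (1 / (M : ℝ)))) atTop (𝓝 0) := by
      have := ENNReal.tendsto_ofReal ((tendsto_one_div_atTop_nhds_zero_nat (𝕜 := ℝ)).const_mul 2)
      simpa using this
    have h2 := ENNReal.Tendsto.const_mul (a := (d : ENNReal)) h1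
      (Or.inr (ENNReal.natCast_ne_top d))
    have h3 := ENNReal.Tendsto.const_mul (a := K) h2 (Or.inr hKtop)
    simpa using h3.const_add R
  exact ge_of_tendsto hlim (eventually_atTop.2 ⟨1, fun M hM => hbound M hM⟩)

theorem abs_rpow_sub_rpow_le {p t x : ℝ} (hp0 : 0 < p) (hp1 : p ≤ 1) (ht : 0 < t) (hx : 0 ≤ x) :
    |x ^ p - t ^ p| ≤ t ^ p / t * |x - t| := by
  have hu : 0 ≤ x / t := div_nonneg hx ht.le
  have key : |(x / t) ^ p - 1| ≤ |x / t - 1| := by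
    rcases le_total (x / t) 1 with h | h
    · have h1 := Real.rpow_le_one hu h hp0.le
      have h2 := Real.self_le_rpow_of_le_one hu h hp1
      rw [abs_of_nonpos (by linarith), abs_of_nonpos (by linarith)]
      linarith
    · have h1 := Real.one_le_rpow h hp0.le
      have h2 := Real.rpow_le_self_of_one_le h hp1
      rw [abs_of_nonneg (by linarith), abs_of_nonneg (by linarith)]
      linarith
  have htp : 0 < t ^ p := Real.rpow_pos_of_pos ht p
  have e1 : x ^ p - t ^ p = t ^ p * ((x / t) ^ p - 1) := by
    rw [Real.div_rpow hx ht.le]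
    field_simp
  have e2 : t ^ p / t * |x - t| = t ^ p * |x / t - 1| := by
    rw [show x - t = t * (x / t - 1) by field_simp, abs_mul, abs_of_pos ht]
    field_simp
  rw [e1, e2, abs_mul, abs_of_pos htp]
  exact mul_le_mul_of_nonneg_left key htp.le

theorem BWexpect_nonneg (d n : ℕ) : 0 ≤ BWexpect d n :=
  integral_nonneg fun _ => Nat.cast_nonneg _

theorem BWexpect_le (d n : ℕ) : BWexpect d n ≤ n := by
  have hle : ∀ X : Fin n → Fin d → ℝ, (chainLength d (range X) : ℝ) ≤ n := fun X => by
    rw [← image_univ]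
    exact_mod_cast chainLength_image_le univ X
  have h := integral_mono_of_nonneg
    (μ := Measure.pi fun _ : Fin n => volume.restrict (Icc (0 : Fin d → ℝ) 1))
    (Eventually.of_forall fun X : Fin n → Fin d → ℝ => Nat.cast_nonneg (chainLength d (range X)))
    (integrable_const (n : ℝ)) (Eventually.of_forall hle)
  simpa [BWexpect] using h

theorem exists_abs_BWexpect_sub_le {d : ℕ} {c : ℝ} (hc : IsBWConstant d c) {η : ℝ} (hη : 0 < η) :
    ∃ K : ℝ, ∀ n : ℕ, |BWexpect d n - c * (n : ℝ) ^ ((1 : ℝ) / d)| ≤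
      η * (n : ℝ) ^ ((1 : ℝ) / d) + K := by
  obtain ⟨N, hN⟩ := Metric.tendsto_atTop.1 hc.2 η hη
  have hp : 0 ≤ (1 : ℝ) / d := by positivity
  have hc0 := hc.1
  set K : ℝ := (N + 1 : ℝ) + c * (N + 1 : ℝ) ^ ((1 : ℝ) / d) with hK
  have hK0 : 0 ≤ K := by positivity
  refine ⟨K, fun n => ?_⟩
  have hnp : 0 ≤ (n : ℝ) ^ ((1 : ℝ) / d) := by positivity
  rcases le_or_gt (N + 1) n with h | h
  · have h1 := hN n (by omega)
    have hn : (0 : ℝ) < n := by exact_mod_cast (show 0 < n by omega)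
    have hpos : 0 < (n : ℝ) ^ ((1 : ℝ) / d) := Real.rpow_pos_of_pos hn _
    rw [Real.dist_eq, neg_div, Real.rpow_neg hn.le] at h1
    have : BWexpect d n - c * (n : ℝ) ^ ((1 : ℝ) / d) =
        (n : ℝ) ^ ((1 : ℝ) / d) * (((n : ℝ) ^ ((1 : ℝ) / d))⁻¹ * BWexpect d n - c) := by
      field_simp
    rw [this, abs_mul, abs_of_pos hpos]
    nlinarith
  · have hn : (n : ℝ) ≤ N + 1 := by exact_mod_cast h.le
    have h1 : (n : ℝ) ^ ((1 : ℝ) / d) ≤ (N + 1 : ℝ) ^ ((1 : ℝ) / d) :=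
      Real.rpow_le_rpow (Nat.cast_nonneg n) hn hp
    have h2 := BWexpect_le d n
    have h3 := BWexpect_nonneg d n
    have h4 := mul_le_mul_of_nonneg_left h1 hc0.le
    have h5 := mul_nonneg hη.le hnp
    have h6 := mul_nonneg hc0.le hnp
    have h7 : (0 : ℝ) ≤ N := Nat.cast_nonneg N
    rw [abs_le]
    constructor <;> linarith

/-- Chernoff bound for the longest chain of `n` independent points. -/
theorem measure_chainLength_deviation_le {d n : ℕ} (ν : Measure (Fin d → ℝ))
    [IsProbabilityMeasure ν] {b D l δ : ℝ} (hl0 : 0 < l) (hl1 : l ≤ 1)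
    (hD : |∫ X, (chainLength d (range X) : ℝ) ∂(Measure.pi fun _ : Fin n => ν) - b| ≤ D) :
    (Measure.pi fun _ : Fin n => ν) {X | δ < |(chainLength d (range X) : ℝ) - b|} ≤
      ENNReal.ofReal (2 * Real.exp (-l * δ + l ^ 2 * b + 2 * l * D)) := by
  set μ := Measure.pi fun _ : Fin n => ν
  set Y : (Fin n → Fin d → ℝ) → ℝ := fun X => (chainLength d (range X) : ℝ) with hY
  set m := ∫ X, Y X ∂μ with hm
  have hDl := abs_le.1 hD
  have hm0 : 0 ≤ m := integral_nonneg fun _ => Nat.cast_nonneg _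
  have hbnd : ∀ a : ℝ, |a| ≤ 1 → Real.exp a - 1 ≤ a + a ^ 2 := fun a ha => by
    have := (abs_le.1 (Real.abs_exp_sub_one_sub_id_le ha)).2
    linarith
  have hmgf : ∀ a : ℝ, |a| ≤ 1 → ProbabilityTheory.mgf Y μ a ≤ Real.exp ((a + a ^ 2) * m) :=
    fun a ha => (integral_exp_chainLength_le ν a).2.trans
      (Real.exp_le_exp.2 (mul_le_mul_of_nonneg_right (hbnd a ha) hm0))
  have habs : |l| ≤ 1 := by rwa [abs_of_pos hl0]
  have hup : μ.real {X | b + δ ≤ Y X} ≤ Real.exp (-l * δ + l ^ 2 * b + 2 * l * D) := by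
    refine (ProbabilityTheory.measure_ge_le_exp_mul_mgf _ hl0.le
      (integral_exp_chainLength_le ν l).1).trans ?_
    refine (mul_le_mul_of_nonneg_left (hmgf l habs) (Real.exp_pos _).le).trans ?_
    rw [← Real.exp_add, Real.exp_le_exp]
    nlinarith [mul_le_mul_of_nonneg_left hDl.2 hl0.le, mul_nonneg hl0.le (sub_nonneg.2 hl1),
      mul_le_mul_of_nonneg_left hDl.2 (sq_nonneg l), (abs_nonneg _).trans hD,
      mul_nonneg (mul_nonneg hl0.le (sub_nonneg.2 hl1)) ((abs_nonneg _).trans hD)]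
  have hlow : μ.real {X | Y X ≤ b - δ} ≤ Real.exp (-l * δ + l ^ 2 * b + 2 * l * D) := by
    refine (ProbabilityTheory.measure_le_le_exp_mul_mgf _ (neg_nonpos.2 hl0.le)
      (integral_exp_chainLength_le ν (-l)).1).trans ?_
    refine (mul_le_mul_of_nonneg_left (hmgf (-l) (by rwa [abs_neg]))
      (Real.exp_pos _).le).trans ?_
    rw [← Real.exp_add, Real.exp_le_exp]
    nlinarith [mul_le_mul_of_nonneg_left hDl.1 hl0.le, mul_nonneg hl0.le (sub_nonneg.2 hl1),
      mul_le_mul_of_nonneg_left hDl.2 (sq_nonneg l), (abs_nonneg _).trans hD,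
      mul_nonneg (mul_nonneg hl0.le (sub_nonneg.2 hl1)) ((abs_nonneg _).trans hD)]
  have hsub : {X | δ < |Y X - b|} ⊆ {X | b + δ ≤ Y X} ∪ {X | Y X ≤ b - δ} := by
    intro X hX
    rcases lt_abs.1 (show δ < |Y X - b| from hX) with h | h
    · exact Or.inl (show b + δ ≤ Y X by linarith)
    · exact Or.inr (show Y X ≤ b - δ by linarith)
  refine (measure_mono hsub).trans ?_
  rw [← ofReal_measureReal]
  refine ENNReal.ofReal_le_ofReal ((measureReal_union_le _ _).trans ?_)
  linarith

theorem tsum_poissonWeight_mul_exp_abs_le {t a : ℝ} (ht : 0 ≤ t) (ha0 : 0 ≤ a) (ha1 : a ≤ 1) :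
    ∑' n : ℕ, poissonWeight t n * ENNReal.ofReal (Real.exp (a * |n - t|)) ≤
      ENNReal.ofReal (2 * Real.exp (a ^ 2 * t)) := by
  have habs : |a| ≤ 1 := by rwa [abs_of_nonneg ha0]
  have hone : ∀ b : ℝ, |b| ≤ 1 →
      ∑' n : ℕ, poissonWeight t n * ENNReal.ofReal (Real.exp (b * (n - t))) ≤
        ENNReal.ofReal (Real.exp (b ^ 2 * t)) := fun b hb => by
    have hterm : ∀ n : ℕ, poissonWeight t n * ENNReal.ofReal (Real.exp (b * (n - t))) =
        poissonWeight t n * ENNReal.ofReal (Real.exp (b * n)) *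
          ENNReal.ofReal (Real.exp (-(b * t))) := fun n => by
      rw [mul_assoc, ← ENNReal.ofReal_mul (Real.exp_pos _).le, ← Real.exp_add]
      ring_nf
    simp_rw [hterm]
    rw [ENNReal.tsum_mul_right, tsum_poissonWeight_mul_exp ht,
      ← ENNReal.ofReal_mul (Real.exp_pos _).le, ← Real.exp_add]
    refine ENNReal.ofReal_le_ofReal (Real.exp_le_exp.2 ?_)
    have := mul_le_mul_of_nonneg_left (abs_le.1 (Real.abs_exp_sub_one_sub_id_le hb)).2 ht
    linarith
  calc _ ≤ ∑' n : ℕ, (poissonWeight t n * ENNReal.ofReal (Real.exp (a * (n - t))) +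
        poissonWeight t n * ENNReal.ofReal (Real.exp (-a * (n - t)))) := by
        refine ENNReal.tsum_le_tsum fun n => ?_
        rw [← mul_add, ← ENNReal.ofReal_add (Real.exp_pos _).le (Real.exp_pos _).le]
        refine mul_le_mul_right (ENNReal.ofReal_le_ofReal ?_) _
        rcases abs_choice ((n : ℝ) - t) with h | h
        · rw [h]
          linarith [Real.exp_pos (-a * (n - t))]
        · rw [h, mul_neg, ← neg_mul]
          linarith [Real.exp_pos (a * (n - t))]
    _ ≤ ENNReal.ofReal (Real.exp (a ^ 2 * t)) + ENNReal.ofReal (Real.exp ((-a) ^ 2 * t)) := by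
        rw [ENNReal.tsum_add]
        exact add_le_add (hone a habs) (hone (-a) (by rwa [abs_neg]))
    _ = _ := by
        rw [neg_sq, ← ENNReal.ofReal_add (Real.exp_pos _).le (Real.exp_pos _).le, two_mul]

/-- Exponential tail bound for the longest chain of a Poisson process in the unit cube. -/
theorem exists_measure_chainLength_deviation_le {d : ℕ} (hd : 0 < d) {c : ℝ}
    (hc : IsBWConstant d c) {Ω : Type*} [MeasurableSpace Ω] (P : Measure Ω)
    [IsProbabilityMeasure P] {ε : ℝ} (hε : 0 < ε) :
    ∃ C κ : ℝ, 0 < κ ∧ ∀ (t : ℝ) (N : PoissonPP d P fun _ => t), 0 < t →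
      P {ω | ε < |t ^ (-(1 : ℝ) / d) * (chainLength d (N.pts ω ∩ Icc 0 1) : ℝ) - c|} ≤
        ENNReal.ofReal (C * Real.exp (-κ * t ^ ((1 : ℝ) / d))) := by
  have hc0 := hc.1
  set η := ε / 8 with hη
  have hη0 : 0 < η := by positivity
  obtain ⟨K, hK⟩ := exists_abs_BWexpect_sub_le hc hη0
  set G := c + η with hG
  have hG0 : 0 < G := by positivity
  obtain ⟨l, hl0, hl1, hlG, hlε⟩ : ∃ l : ℝ, 0 < l ∧ l ≤ 1 ∧ 2 * l * G ≤ 1 ∧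
      l * (c + 4 * G ^ 2) ≤ ε / 4 := by
    refine ⟨min 1 (min (1 / (2 * G)) (ε / 4 / (c + 4 * G ^ 2))), by positivity,
      min_le_left _ _, ?_, ?_⟩
    · have h := (min_le_right (1 : ℝ) _).trans (min_le_left (1 / (2 * G)) (ε / 4 / (c + 4 * G ^ 2)))
      rw [le_div_iff₀ (by positivity)] at h
      linarith
    · have h := (min_le_right (1 : ℝ) _).trans
        (min_le_right (1 / (2 * G)) (ε / 4 / (c + 4 * G ^ 2)))
      rwa [le_div_iff₀ (by positivity)] at h
  set κ := l * ε / 2 with hκ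
  have hκ0 : 0 < κ := by positivity
  have hp0 : 0 < (1 : ℝ) / d := by positivity
  have hp1 : (1 : ℝ) / d ≤ 1 := by
    rw [div_le_one (by positivity)]
    exact_mod_cast hd
  refine ⟨max (4 * Real.exp (2 * l * K)) (Real.exp κ), κ, hκ0, fun t N ht => ?_⟩
  set s := t ^ ((1 : ℝ) / d) with hs
  have hs0 : 0 < s := Real.rpow_pos_of_pos ht _
  rcases le_or_gt 1 t with h1 | h1
  · have hst : s ≤ t := Real.rpow_le_self_of_one_le h1 hp1
    have hset : {ω | ε < |t ^ (-(1 : ℝ) / d) * (chainLength d (N.pts ω ∩ Icc 0 1) : ℝ) - c|} =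
        {ω | chainLength d (N.pts ω ∩ Icc 0 1) ∈ {k : ℕ | ε * s < |(k : ℝ) - c * s|}} := by
      ext ω
      simp only [mem_ofPred_eq]
      rw [neg_div, Real.rpow_neg ht.le, ← hs, ← lt_div_iff₀ hs0, ← abs_of_pos hs0, ← abs_div,
        abs_of_pos hs0]
      congr! 2
      field_simp
    rw [hset]
    refine (measure_chainLength_mem_le hd ht.le N _).trans ?_
    set a := 2 * l * G * (s / t) with ha
    have hr0 : 0 < s / t := div_pos hs0 ht
    have hr1 : s / t ≤ 1 := (div_le_one ht).2 hst
    have ha0 : 0 ≤ a := by positivity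
    have ha1 : a ≤ 1 := mul_le_one₀ hlG hr0.le hr1
    set A := 2 * Real.exp (-l * (ε * s) + l ^ 2 * (c * s) + 2 * l * (η * s + K)) with hA
    have hterm : ∀ n : ℕ, (Measure.pi fun _ : Fin n => volume.restrict (Icc (0 : Fin d → ℝ) 1))
        {X | chainLength d (range X) ∈ {k : ℕ | ε * s < |(k : ℝ) - c * s|}} ≤
          ENNReal.ofReal A * ENNReal.ofReal (Real.exp (a * |n - t|)) := fun n => by
      have hroot := abs_rpow_sub_rpow_le hp0 hp1 ht (Nat.cast_nonneg n)
      rw [← hs] at hroot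
      have hD : |BWexpect d n - c * s| ≤ η * s + K + G * (s / t * |n - t|) := by
        have e : BWexpect d n - c * s = (BWexpect d n - c * (n : ℝ) ^ ((1 : ℝ) / d)) +
            c * ((n : ℝ) ^ ((1 : ℝ) / d) - s) := by ring
        rw [e]
        refine (abs_add_le _ _).trans ?_
        rw [abs_mul, abs_of_pos hc0]
        have h2 := mul_le_mul_of_nonneg_left hroot hc0.le
        have h3 := mul_le_mul_of_nonneg_left ((le_abs_self _).trans hroot) hη0.le
        have h4 := hK n
        rw [hG]
        linarith
      refine (measure_chainLength_deviation_le _ hl0 hl1 hD).trans (le_of_eq ?_)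
      rw [← ENNReal.ofReal_mul (by positivity), hA, mul_assoc 2 (Real.exp _), ← Real.exp_add]
      congr 3
      rw [ha]
      ring
    calc _ ≤ ∑' n : ℕ, poissonWeight t n * ENNReal.ofReal (Real.exp (a * |n - t|)) *
          ENNReal.ofReal A := ENNReal.tsum_le_tsum fun n => by
            rw [mul_assoc, mul_comm (ENNReal.ofReal (Real.exp _))]
            exact mul_le_mul_right (hterm n) _
      _ ≤ ENNReal.ofReal (2 * Real.exp (a ^ 2 * t)) * ENNReal.ofReal A := by
          rw [ENNReal.tsum_mul_right]
          exact mul_le_mul_left (tsum_poissonWeight_mul_exp_abs_le ht.le ha0 ha1) _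
      _ ≤ _ := by
          rw [← ENNReal.ofReal_mul (by positivity)]
          refine ENNReal.ofReal_le_ofReal ?_
          refine le_trans ?_ (mul_le_mul_of_nonneg_right (le_max_left _ _) (Real.exp_pos _).le)
          have hat : a ^ 2 * t ≤ 4 * l ^ 2 * G ^ 2 * s := by
            have : a ^ 2 * t = 4 * l ^ 2 * G ^ 2 * s * (s / t) := by
              rw [ha]
              field_simp
              ring
            rw [this]
            exact mul_le_of_le_one_right (by positivity) hr1
          have hexp : a ^ 2 * t + (-l * (ε * s) + l ^ 2 * (c * s) + 2 * l * (η * s + K)) ≤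
              2 * l * K + -κ * s := by
            have := mul_le_mul_of_nonneg_left hlε (mul_pos hl0 hs0).le
            rw [hκ, hη]
            nlinarith
          rw [hA]
          calc _ = 4 * Real.exp (a ^ 2 * t +
                (-l * (ε * s) + l ^ 2 * (c * s) + 2 * l * (η * s + K))) := by
                rw [Real.exp_add (a ^ 2 * t)]; ring
            _ ≤ 4 * Real.exp (2 * l * K + -κ * s) := by gcongr
            _ = _ := by rw [Real.exp_add]; ring
  · have hs1 : s ≤ 1 := Real.rpow_le_one ht.le h1.le hp0.le
    refine prob_le_one.trans ?_
    rw [← ENNReal.ofReal_one]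
    refine ENNReal.ofReal_le_ofReal ?_
    refine le_trans ?_ (mul_le_mul_of_nonneg_right (le_max_right _ _) (Real.exp_pos _).le)
    rw [← Real.exp_add]
    exact Real.one_le_exp (by nlinarith)

/-- Complete convergence `t_n^{-1/d} L_{t_n} → c_d` for the longest chain among
Poisson points of intensity `t_n` in the unit cube, whenever
`∑_n exp(-ε t_n^{1/d}) < ∞` for every `ε > 0`. -/
theorem longest_chain_complete_convergence
    {d : ℕ} (hd : 0 < d) (c : ℝ) (hc : IsBWConstant d c)
    {Ω : Type*} [MeasurableSpace Ω] (P : Measure Ω) [IsProbabilityMeasure P]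
    (PP : ∀ t : ℝ, 0 < t → PoissonPP d P fun _ => t)
    (t : ℕ → ℝ) (htpos : ∀ n, 0 < t n) (htmono : StrictMono t)
    (htsum : ∀ ε : ℝ, 0 < ε →
      Summable fun n : ℕ => Real.exp (-ε * t n ^ ((1 : ℝ) / d))) :
    ∀ ε : ℝ, 0 < ε →
      (∑' n : ℕ, P {ω |
        ε < |t n ^ (-(1 : ℝ) / d) *
          (chainLength d ((PP (t n) (htpos n)).pts ω ∩
            Set.Icc (0 : Fin d → ℝ) 1) : ℝ) - c|}) < ⊤ := by
  intro ε hε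
  obtain ⟨C, κ, hκ, h⟩ := exists_measure_chainLength_deviation_le hd hc P hε
  exact (ENNReal.tsum_le_tsum fun n => h (t n) (PP (t n) (htpos n)) (htpos n)).trans_lt
    ((htsum κ hκ).mul_left C).tsum_ofReal_lt_top

end
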